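/- Let ρ and σ be density matrices on ℂ^d with s(ρ) ≤ s(σ), and let r ≥ 0. For each n ∈ ℕ let β_n(r) := max{Tr(ρ^{⊗n} T) : T a matrix on (ℂ^d)^{⊗n} with 0 ≤ T ≤ I and Tr(σ^{⊗n} T) ≤ e^{−nr}} be the maximal type I success probability at type II level e^{−nr}. Then the limit lim_{n→∞} −(1/n) log β_n(r) exists and equals the Hoeffding anti-divergence H*_r(ρ‖σ). -/

import Mathlib

open scoped ENNReal ComplexOrder Classical

namespace QRD

variable {n : Type*} [Fintype n] [DecidableEq n]

/-- Functional calculus for Hermitian matrices (junk value `0` otherwise). -/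
noncomputable def matFun (A : Matrix n n ℂ) (f : ℝ → ℝ) : Matrix n n ℂ :=
  if hA : A.IsHermitian then
    (hA.eigenvectorUnitary : Matrix n n ℂ) *
      Matrix.diagonal (fun i => (f (hA.eigenvalues i) : ℂ)) *
      (star (hA.eigenvectorUnitary : Matrix n n ℂ))
  else 0

/-- The support projection `s(A)` of a Hermitian matrix. -/
noncomputable def supp (A : Matrix n n ℂ) : Matrix n n ℂ :=
  matFun A (fun x => if x = 0 then 0 else 1)

/-- The functional-calculus power `A^t` taken on the support of `A`. -/
noncomputable def matPow (A : Matrix n n ℂ) (t : ℝ) : Matrix n n ℂ :=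
  matFun A (fun x => if x = 0 then 0 else x ^ t)

/-- The functional-calculus logarithm taken on the support of `A`. -/
noncomputable def matLog (A : Matrix n n ℂ) : Matrix n n ℂ :=
  matFun A Real.log

/-- `suppLE ρ σ` means `s(ρ) ≤ s(σ)`, i.e. `ker σ ⊆ ker ρ`. -/
def suppLE (ρ σ : Matrix n n ℂ) : Prop :=
  LinearMap.ker σ.mulVecLin ≤ LinearMap.ker ρ.mulVecLin

/-- Loewner order: `A ≤ B` iff `B - A` is positive semidefinite. -/
def loewnerLE (A B : Matrix n n ℂ) : Prop := (B - A).PosSemidef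

/-- A density matrix: positive semidefinite with unit trace. -/
def IsDensityMatrix (ρ : Matrix n n ℂ) : Prop := ρ.PosSemidef ∧ ρ.trace = 1

/-- The quantity `Q^*_α(ρ‖σ)`, with values in `[0,∞]`. -/
noncomputable def Qstar (α : ℝ) (ρ σ : Matrix n n ℂ) : ℝ≥0∞ :=
  if 1 < α ∧ ¬ suppLE ρ σ then ⊤
  else ENNReal.ofReal
    ((matPow (matPow σ ((1 - α) / (2 * α)) * ρ * matPow σ ((1 - α) / (2 * α))) α).trace.re)

/-- The sandwiched Rényi `α`-divergence `D^*_α(ρ‖σ)`. -/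
noncomputable def Dstar (α : ℝ) (ρ σ : Matrix n n ℂ) : EReal :=
  (((α - 1)⁻¹ : ℝ) : EReal) * (Qstar α ρ σ).log

/-- The Hoeffding anti-divergence `H^*_r(ρ‖σ)`. -/
noncomputable def Hstar (r : ℝ) (ρ σ : Matrix n n ℂ) : EReal :=
  ⨆ α ∈ Set.Ioi (1 : ℝ), ((((α - 1) / α : ℝ) : EReal) * ((r : EReal) - Dstar α ρ σ))

/-- The Umegaki relative entropy `D(ρ‖σ)`. -/
noncomputable def Drel (ρ σ : Matrix n n ℂ) : EReal :=
  if suppLE ρ σ then (((ρ * (matLog ρ - matLog σ)).trace.re : ℝ) : EReal) else ⊤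

/-- The max-relative entropy `D_max(ρ‖σ)`. -/
noncomputable def Dmax (ρ σ : Matrix n n ℂ) : EReal :=
  if ∃ γ : ℝ, 0 ≤ γ ∧ loewnerLE ρ (γ • σ) then
    ((Real.log (sInf {γ : ℝ | 0 ≤ γ ∧ loewnerLE ρ (γ • σ)}) : ℝ) : EReal)
  else ⊤

/-- The `n`-fold Kronecker tensor power of a `d × d` matrix. -/
noncomputable def tensorPow {d : ℕ} (ρ : Matrix (Fin d) (Fin d) ℂ) (N : ℕ) :
    Matrix (Fin N → Fin d) (Fin N → Fin d) ℂ :=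
  Matrix.of fun x y => ∏ i, ρ (x i) (y i)

/-- A (quantum) test: `0 ≤ T ≤ 1` in the Loewner order. -/
def IsTest {m : Type*} [Fintype m] [DecidableEq m] (T : Matrix m m ℂ) : Prop :=
  T.PosSemidef ∧ (1 - T).PosSemidef

/-- `-(1/n) log x`, with the convention `-log 0 = +∞`. -/
noncomputable def expRate (N : ℕ) (x : ℝ) : EReal :=
  if x = 0 then ⊤ else ((-(N : ℝ)⁻¹ * Real.log x : ℝ) : EReal)

end QRD

namespace QRD

/-- The maximal type I success probability at type II level `e^{−nr}`:
`β_n(r) = max{Tr(ρ^{⊗n} T) : 0 ≤ T ≤ I, Tr(σ^{⊗n} T) ≤ e^{−nr}}`. -/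
noncomputable def maxSuccess {d : ℕ} (ρ σ : Matrix (Fin d) (Fin d) ℂ) (r : ℝ) (N : ℕ) : ℝ :=
  sSup {x : ℝ |
    ∃ T : Matrix (Fin N → Fin d) (Fin N → Fin d) ℂ, IsTest T ∧
      (tensorPow σ N * T).trace.re ≤ Real.exp (-(N * r)) ∧
      x = (tensorPow ρ N * T).trace.re}

end QRD

namespace QRD

open Matrix Finset

section Spectral

variable {m : Type*} [Fintype m] [DecidableEq m]

/-- `A = W diag(a) Wᴴ` with `W` unitary. -/
structure IsSpectral (A W : Matrix m m ℂ) (a : m → ℝ) : Prop where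
  unitary : Wᴴ * W = 1
  eq : A = W * diagonal (fun i => (a i : ℂ)) * Wᴴ

/-- `W diag(a) Wᴴ`. -/
noncomputable def conjDiag (W : Matrix m m ℂ) (a : m → ℝ) : Matrix m m ℂ :=
  W * diagonal (fun i => (a i : ℂ)) * Wᴴ

lemma IsSpectral.unitary' {A W : Matrix m m ℂ} {a : m → ℝ} (h : IsSpectral A W a) :
    W * Wᴴ = 1 := mul_eq_one_comm.mp h.unitary

lemma isSpectral_conjDiag {W : Matrix m m ℂ} (hW : Wᴴ * W = 1) (a : m → ℝ) :
    IsSpectral (conjDiag W a) W a := ⟨hW, rfl⟩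

lemma conjDiag_mul {W : Matrix m m ℂ} (hW : Wᴴ * W = 1) (a b : m → ℝ) :
    conjDiag W a * conjDiag W b = conjDiag W (fun i => a i * b i) := by
  unfold conjDiag
  calc _ = W * diagonal (fun i => (a i : ℂ)) * (Wᴴ * W) * diagonal (fun i => (b i : ℂ)) * Wᴴ := by
        simp only [Matrix.mul_assoc]
    _ = _ := by
        rw [hW, Matrix.mul_one, Matrix.mul_assoc W, diagonal_mul_diagonal]; simp

lemma conjDiag_conjTranspose (W : Matrix m m ℂ) (a : m → ℝ) :
    (conjDiag W a)ᴴ = conjDiag W a := by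
  simp only [conjDiag, conjTranspose_mul, conjTranspose_conjTranspose, diagonal_conjTranspose,
    Matrix.mul_assoc]
  congr 3
  ext i
  simp

lemma conjDiag_posSemidef (W : Matrix m m ℂ) {a : m → ℝ} (ha : ∀ i, 0 ≤ a i) :
    (conjDiag W a).PosSemidef := by
  have : (diagonal (fun i => (a i : ℂ))).PosSemidef :=
    PosSemidef.diagonal (fun i => by simpa using ha i)
  exact this.mul_mul_conjTranspose_same W

lemma IsHermitian.isSpectral {A : Matrix m m ℂ} (hA : A.IsHermitian) :
    IsSpectral A (hA.eigenvectorUnitary : Matrix m m ℂ) hA.eigenvalues := by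
  refine ⟨?_, ?_⟩
  · have := (Matrix.mem_unitaryGroup_iff').mp hA.eigenvectorUnitary.2
    simpa [star_eq_conjTranspose] using this
  · have := hA.spectral_theorem
    rw [Unitary.conjStarAlgAut_apply] at this
    exact this

lemma exists_isSpectral {A : Matrix m m ℂ} (hA : A.PosSemidef) :
    ∃ W a, IsSpectral A W a ∧ ∀ i, 0 ≤ a i :=
  ⟨_, _, IsHermitian.isSpectral hA.1, hA.eigenvalues_nonneg⟩

lemma IsSpectral.isHermitian {A W : Matrix m m ℂ} {a : m → ℝ} (h : IsSpectral A W a) :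
    A.IsHermitian := by
  rw [h.eq]; exact conjDiag_conjTranspose W a

lemma diagonal_mul_comm_of_intertwine {M : Matrix m m ℂ} {a b : m → ℝ} (f : ℝ → ℝ)
    (h : diagonal (fun i => (a i : ℂ)) * M = M * diagonal (fun i => (b i : ℂ))) :
    diagonal (fun i => (f (a i) : ℂ)) * M = M * diagonal (fun i => (f (b i) : ℂ)) := by
  ext i j
  have hij := congrFun (congrFun h i) j
  simp only [diagonal_mul, mul_diagonal] at hij ⊢
  by_cases hM : M i j = 0
  · simp [hM]
  · rw [mul_comm (M i j)] at hij ⊢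
    have := mul_right_cancel₀ hM hij
    rw [Complex.ofReal_inj] at this
    rw [this]

lemma IsSpectral.conjDiag_comp_eq {A W V : Matrix m m ℂ} {a b : m → ℝ} (hW : IsSpectral A W a)
    (hV : IsSpectral A V b) (f : ℝ → ℝ) :
    conjDiag W (fun i => f (a i)) = conjDiag V (fun i => f (b i)) := by
  have h : diagonal (fun i => (a i : ℂ)) * (Wᴴ * V) = (Wᴴ * V) * diagonal (fun i => (b i : ℂ)) := by
    calc _ = (Wᴴ * W) * diagonal (fun i => (a i : ℂ)) * Wᴴ * V := by
          rw [hW.unitary, Matrix.one_mul, Matrix.mul_assoc]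
      _ = Wᴴ * A * V := by rw [hW.eq]; simp only [Matrix.mul_assoc]
      _ = (Wᴴ * V) * diagonal (fun i => (b i : ℂ)) * (Vᴴ * V) := by
          rw [hV.eq]; simp only [Matrix.mul_assoc]
      _ = _ := by rw [hV.unitary, Matrix.mul_one]
  have h2 := diagonal_mul_comm_of_intertwine f h
  unfold conjDiag
  calc _ = W * (diagonal (fun i => (f (a i) : ℂ)) * (Wᴴ * V)) * Vᴴ := by
        simp only [Matrix.mul_assoc, hV.unitary', Matrix.mul_one]
    _ = (W * Wᴴ) * V * diagonal (fun i => (f (b i) : ℂ)) * Vᴴ := by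
        rw [h2]; simp only [Matrix.mul_assoc]
    _ = _ := by rw [hW.unitary', Matrix.one_mul]

lemma IsSpectral.matFun_eq {A W : Matrix m m ℂ} {a : m → ℝ} (h : IsSpectral A W a)
    (f : ℝ → ℝ) : matFun A f = conjDiag W (fun i => f (a i)) := by
  rw [matFun, dif_pos h.isHermitian]
  exact (IsHermitian.isSpectral h.isHermitian).conjDiag_comp_eq h f

lemma trace_conjDiag {W : Matrix m m ℂ} (hW : Wᴴ * W = 1) (a : m → ℝ) :
    (conjDiag W a).trace = ((∑ i, a i : ℝ) : ℂ) := by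
  rw [conjDiag, trace_mul_comm, ← Matrix.mul_assoc, hW, Matrix.one_mul, trace_diagonal]
  simp

lemma IsSpectral.sum_comp_eq_of_charpoly_eq {A B W V : Matrix m m ℂ} {a b : m → ℝ}
    (hW : IsSpectral A W a) (hV : IsSpectral B V b) (h : A.charpoly = B.charpoly) (f : ℝ → ℝ) :
    ∑ i, f (a i) = ∑ i, f (b i) := by
  have key : ∀ {C X : Matrix m m ℂ} {c : m → ℝ}, IsSpectral C X c →
      ((C.charpoly.roots.map Complex.re).map f).sum = ∑ i, f (c i) := by
    intro C X c hC
    have h1 : C.charpoly = (diagonal (fun i => (c i : ℂ))).charpoly := by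
      rw [hC.eq, charpoly_mul_comm, ← Matrix.mul_assoc, hC.unitary, Matrix.one_mul]
    have h2 : (diagonal (fun i => (c i : ℂ))).charpoly.roots =
        univ.val.map (fun i => (c i : ℂ)) := by
      rw [charpoly_diagonal, ← Polynomial.roots_multiset_prod_X_sub_C
        (univ.val.map fun i => (c i : ℂ)), Multiset.map_map]
      rfl
    rw [h1, h2, Multiset.map_map, Multiset.map_map]
    rfl
  rw [← key hW, ← key hV, h]

end Spectral

section Trace

variable {m : Type*} [Fintype m] [DecidableEq m]

lemma trace_mul_re_nonneg {A B : Matrix m m ℂ} (hA : A.PosSemidef) (hB : B.PosSemidef) :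
    0 ≤ (A * B).trace.re := by
  obtain ⟨W, a, hW, ha⟩ := exists_isSpectral hA
  have h1 : (Wᴴ * B * W).PosSemidef := hB.conjTranspose_mul_mul_same W
  have : (A * B).trace = ∑ i, (a i : ℂ) * (Wᴴ * B * W) i i := by
    rw [hW.eq, Matrix.mul_assoc, Matrix.mul_assoc, trace_mul_comm, Matrix.mul_assoc, trace]
    simp [diagonal_mul]
  rw [this, Complex.re_sum]
  refine Finset.sum_nonneg fun i _ => ?_
  rw [Complex.re_ofReal_mul]
  exact mul_nonneg (ha i) (Complex.nonneg_iff.mp (h1.diag_nonneg (i := i))).1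

lemma trace_mul_re_mono {A B C : Matrix m m ℂ} (hAB : (B - A).PosSemidef) (hC : C.PosSemidef) :
    (A * C).trace.re ≤ (B * C).trace.re := by
  have := trace_mul_re_nonneg hAB hC
  rw [Matrix.sub_mul, trace_sub, Complex.sub_re] at this
  linarith

lemma sum_normSq_row {M : Matrix m m ℂ} (h : M * Mᴴ = 1) (i : m) :
    ∑ j, Complex.normSq (M i j) = 1 := by
  have := congrFun (congrFun h i) i
  rw [mul_apply] at this
  simp only [conjTranspose_apply, RCLike.star_def, Complex.mul_conj, one_apply_eq] at this
  exact_mod_cast this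

lemma sum_normSq_col {M : Matrix m m ℂ} (h : Mᴴ * M = 1) (j : m) :
    ∑ i, Complex.normSq (M i j) = 1 := by
  have := sum_normSq_row (M := Mᴴ) (by simpa using h) j
  simpa [conjTranspose_apply] using this

/-- The trace of a product in terms of overlaps of eigenbases. -/
lemma trace_conjDiag_mul_conjDiag (W V : Matrix m m ℂ) (a b : m → ℝ) :
    (conjDiag W a * conjDiag V b).trace =
      ((∑ i, ∑ j, a i * b j * Complex.normSq ((Wᴴ * V) i j) : ℝ) : ℂ) := by
  have : (conjDiag W a * conjDiag V b).trace =
      ((diagonal (fun i => (a i : ℂ)) * (Wᴴ * V)) *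
        (diagonal (fun i => (b i : ℂ)) * (Wᴴ * V)ᴴ)).trace := by
    unfold conjDiag
    rw [Matrix.mul_assoc, Matrix.mul_assoc, trace_mul_comm]
    simp only [Matrix.mul_assoc, conjTranspose_mul, conjTranspose_conjTranspose]
  rw [this, trace]
  push_cast
  refine Finset.sum_congr rfl fun i _ => ?_
  rw [diag_apply, mul_apply]
  refine Finset.sum_congr rfl fun j _ => ?_
  rw [diagonal_mul, diagonal_mul, conjTranspose_apply, ← Complex.mul_conj]
  simp only [RCLike.star_def]
  ring

/-- Hölder's inequality for the trace of a product of positive semidefinite matrices. -/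
lemma trace_mul_le_holder {A B W V : Matrix m m ℂ} {a b : m → ℝ} (hA : IsSpectral A W a)
    (hB : IsSpectral B V b) (ha : ∀ i, 0 ≤ a i) (hb : ∀ i, 0 ≤ b i) {p q : ℝ}
    (hpq : p.HolderConjugate q) :
    (A * B).trace.re ≤ (∑ i, a i ^ p) ^ (1 / p) * (∑ i, b i ^ q) ^ (1 / q) := by
  set M := Wᴴ * V with hM
  have hM1 : Mᴴ * M = 1 := by
    rw [hM, conjTranspose_mul, conjTranspose_conjTranspose]
    calc _ = Vᴴ * (W * Wᴴ) * V := by simp only [Matrix.mul_assoc]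
      _ = 1 := by rw [hA.unitary', Matrix.mul_one, hB.unitary]
  have hM2 : M * Mᴴ = 1 := mul_eq_one_comm.mp hM1
  have htr : (A * B).trace.re = ∑ x : m × m, a x.1 * b x.2 * Complex.normSq (M x.1 x.2) := by
    rw [hA.eq, hB.eq]
    change (conjDiag W a * conjDiag V b).trace.re = _
    rw [trace_conjDiag_mul_conjDiag, Complex.ofReal_re, Fintype.sum_prod_type]
  have hp := hpq.pos
  have hq := hpq.symm.pos
  have hw : ∀ x : m × m, 0 ≤ Complex.normSq (M x.1 x.2) := fun x => Complex.normSq_nonneg _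
  have h := Real.inner_le_Lp_mul_Lq_of_nonneg (univ : Finset (m × m))
    (f := fun x => a x.1 * Complex.normSq (M x.1 x.2) ^ (1 / p))
    (g := fun x => b x.2 * Complex.normSq (M x.1 x.2) ^ (1 / q)) hpq
    (fun x _ => mul_nonneg (ha _) (Real.rpow_nonneg (hw x) _))
    (fun x _ => mul_nonneg (hb _) (Real.rpow_nonneg (hw x) _))
  have e1 : ∑ x : m × m, (a x.1 * Complex.normSq (M x.1 x.2) ^ (1 / p)) ^ p = ∑ i, a i ^ p := by
    rw [Fintype.sum_prod_type]
    refine Finset.sum_congr rfl fun i _ => ?_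
    have : ∀ j, (a i * Complex.normSq (M i j) ^ (1 / p)) ^ p =
        a i ^ p * Complex.normSq (M i j) := fun j => by
      rw [Real.mul_rpow (ha i) (Real.rpow_nonneg (hw (i, j)) _), ← Real.rpow_mul (hw (i, j)),
        one_div_mul_cancel hp.ne', Real.rpow_one]
    simp only [this]
    rw [← Finset.mul_sum, sum_normSq_row hM2, mul_one]
  have e2 : ∑ x : m × m, (b x.2 * Complex.normSq (M x.1 x.2) ^ (1 / q)) ^ q = ∑ i, b i ^ q := by
    rw [Fintype.sum_prod_type_right]
    refine Finset.sum_congr rfl fun i _ => ?_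
    have : ∀ j, (b i * Complex.normSq (M j i) ^ (1 / q)) ^ q =
        b i ^ q * Complex.normSq (M j i) := fun j => by
      rw [Real.mul_rpow (hb i) (Real.rpow_nonneg (hw (j, i)) _), ← Real.rpow_mul (hw (j, i)),
        one_div_mul_cancel hq.ne', Real.rpow_one]
    simp only [this]
    rw [← Finset.mul_sum, sum_normSq_col hM1, mul_one]
  rw [e1, e2] at h
  rw [htr]
  refine le_trans (le_of_eq ?_) h
  refine Finset.sum_congr rfl fun x _ => ?_
  have : Complex.normSq (M x.1 x.2) ^ (1 / p) * Complex.normSq (M x.1 x.2) ^ (1 / q) =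
      Complex.normSq (M x.1 x.2) := by
    rw [← Real.rpow_add_of_nonneg (hw x) (by positivity) (by positivity)]
    have : 1 / p + 1 / q = 1 := by simpa using hpq.inv_add_inv_eq_one
    rw [this, Real.rpow_one]
  calc _ = a x.1 * b x.2 * (Complex.normSq (M x.1 x.2) ^ (1 / p) *
        Complex.normSq (M x.1 x.2) ^ (1 / q)) := by rw [this]
    _ = _ := by ring

/-- Monotonicity of `A ↦ Tr A^p` in the Loewner order. -/
lemma sum_rpow_le_of_sub_posSemidef {A B W V : Matrix m m ℂ} {a b : m → ℝ}
    (hA : IsSpectral A W a) (hB : IsSpectral B V b) (ha : ∀ i, 0 ≤ a i) (hb : ∀ i, 0 ≤ b i)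
    {c : ℝ} (hc : 0 ≤ c) (hle : ((c : ℂ) • B - A).PosSemidef) {p : ℝ} (hp : 1 < p) :
    ∑ i, a i ^ p ≤ c ^ p * ∑ i, b i ^ p := by
  have hp0 : 0 < p := by linarith
  set q := p / (p - 1) with hq
  have hpq : p.HolderConjugate q := Real.HolderConjugate.conjExponent hp
  have hq0 := hpq.symm.pos
  set Y := conjDiag W (fun i => a i ^ (p - 1)) with hY
  have hYs : IsSpectral Y W _ := isSpectral_conjDiag hA.unitary _
  have hYp : Y.PosSemidef := conjDiag_posSemidef W fun i => Real.rpow_nonneg (ha i) _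
  have h1 := trace_mul_re_mono hle hYp
  have h2 : (A * Y).trace.re = ∑ i, a i ^ p := by
    have : A = conjDiag W a := hA.eq
    rw [this, hY, conjDiag_mul hA.unitary, trace_conjDiag hA.unitary, Complex.ofReal_re]
    refine Finset.sum_congr rfl fun i _ => ?_
    rcases (ha i).eq_or_lt with h | h
    · rw [← h, zero_mul, Real.zero_rpow hp0.ne']
    · nth_rewrite 1 [← Real.rpow_one (a i)]
      rw [← Real.rpow_add h]; congr 1; ring
  have h3 := trace_mul_le_holder hB hYs hb (fun i => Real.rpow_nonneg (ha i) _) hpq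
  have h4 : ∑ i, (a i ^ (p - 1)) ^ q = ∑ i, a i ^ p := by
    refine Finset.sum_congr rfl fun i _ => ?_
    rw [← Real.rpow_mul (ha i), hq, mul_div_cancel₀ _ (by linarith : p - 1 ≠ 0)]
  rw [h4] at h3
  rw [h2, Matrix.smul_mul, trace_smul, smul_eq_mul, Complex.re_ofReal_mul] at h1
  set Z := ∑ i, a i ^ p with hZ
  set S := ∑ i, b i ^ p with hS
  have hZ0 : 0 ≤ Z := Finset.sum_nonneg fun i _ => Real.rpow_nonneg (ha i) _
  have hS0 : 0 ≤ S := Finset.sum_nonneg fun i _ => Real.rpow_nonneg (hb i) _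
  rcases hZ0.eq_or_lt with h | h
  · rw [← h]; positivity
  have h5 : Z ≤ c * (S ^ (1 / p) * Z ^ (1 / q)) := h1.trans (mul_le_mul_of_nonneg_left h3 hc)
  have h6 : Z = Z ^ (1 / p) * Z ^ (1 / q) := by
    rw [← Real.rpow_add h]
    have : 1 / p + 1 / q = 1 := by simpa using hpq.inv_add_inv_eq_one
    rw [this, Real.rpow_one]
  have h7 : Z ^ (1 / p) ≤ c * S ^ (1 / p) := by
    have hz : 0 < Z ^ (1 / q) := Real.rpow_pos_of_pos h _
    refine le_of_mul_le_mul_right ?_ hz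
    rw [← h6]; linarith
  calc Z = (Z ^ (1 / p)) ^ p := by
        rw [← Real.rpow_mul hZ0, one_div_mul_cancel hp0.ne', Real.rpow_one]
    _ ≤ (c * S ^ (1 / p)) ^ p := Real.rpow_le_rpow (by positivity) h7 hp0.le
    _ = c ^ p * S := by
        rw [Real.mul_rpow hc (by positivity), ← Real.rpow_mul hS0, one_div_mul_cancel hp0.ne',
          Real.rpow_one]

end Trace

end QRD

namespace QRD

open Matrix Finset

section TensorPower

variable {X : Type*} [Fintype X] [DecidableEq X] (κ : Type*) [Fintype κ] [DecidableEq κ]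

/-- The tensor power of a matrix indexed by an arbitrary finite type of copies. -/
noncomputable def tp (A : Matrix X X ℂ) : Matrix (κ → X) (κ → X) ℂ :=
  Matrix.of fun x y => ∏ i, A (x i) (y i)

omit [Fintype X] [DecidableEq X] [DecidableEq κ] in
lemma tp_apply (A : Matrix X X ℂ) (x y : κ → X) : tp κ A x y = ∏ i, A (x i) (y i) := rfl

omit [DecidableEq X] in
lemma tp_mul (A B : Matrix X X ℂ) : tp κ (A * B) = tp κ A * tp κ B := by
  ext x y
  simp only [tp_apply, mul_apply, Fintype.prod_sum, Finset.prod_mul_distrib]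

omit [Fintype X] [DecidableEq X] [DecidableEq κ] in
lemma tp_conjTranspose (A : Matrix X X ℂ) : tp κ Aᴴ = (tp κ A)ᴴ := by
  ext x y
  simp [tp_apply, conjTranspose_apply]

omit [Fintype X] [DecidableEq κ] in
lemma tp_diagonal (a : X → ℝ) :
    tp κ (diagonal fun i => (a i : ℂ)) = diagonal fun x => ((∏ i, a (x i) : ℝ) : ℂ) := by
  ext x y
  rw [tp_apply]
  by_cases h : x = y
  · subst h; simp
  · obtain ⟨i, hi⟩ := Function.ne_iff.mp h
    rw [diagonal_apply_ne _ h]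
    exact Finset.prod_eq_zero (mem_univ i) (diagonal_apply_ne _ hi)

omit [Fintype X] [DecidableEq κ] in
lemma tp_one : tp κ (1 : Matrix X X ℂ) = 1 := by
  have := tp_diagonal (X := X) κ (fun _ => 1)
  simpa using this

lemma tp_conjDiag (W : Matrix X X ℂ) (a : X → ℝ) :
    tp κ (conjDiag W a) = conjDiag (tp κ W) (fun x => ∏ i, a (x i)) := by
  rw [conjDiag, tp_mul, tp_mul, tp_diagonal, tp_conjTranspose]; rfl

lemma tp_unitary {W : Matrix X X ℂ} (hW : Wᴴ * W = 1) : (tp κ W)ᴴ * tp κ W = 1 := by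
  rw [← tp_conjTranspose, ← tp_mul, hW, tp_one]

lemma IsSpectral.tp {A W : Matrix X X ℂ} {a : X → ℝ} (h : IsSpectral A W a) :
    IsSpectral (tp κ A) (tp κ W) (fun x => ∏ i, a (x i)) := by
  refine ⟨tp_unitary κ h.unitary, ?_⟩
  have : A = conjDiag W a := h.eq
  rw [this, tp_conjDiag]; rfl

omit [DecidableEq X] in
lemma trace_tp (A : Matrix X X ℂ) : (QRD.tp κ A).trace = A.trace ^ Fintype.card κ := by
  simp only [trace, diag_apply, tp_apply]
  rw [← Finset.card_univ, ← Finset.prod_const, Fintype.prod_sum]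

lemma tp_posSemidef {A : Matrix X X ℂ} (hA : A.PosSemidef) : (QRD.tp κ A).PosSemidef := by
  obtain ⟨W, a, h, ha⟩ := exists_isSpectral hA
  rw [(h.tp κ).eq]
  exact conjDiag_posSemidef _ fun x => Finset.prod_nonneg fun i _ => ha _

end TensorPower

section Converse

variable {m : Type*} [Fintype m] [DecidableEq m]

lemma conjTranspose_mul_diagonal_mul_diag (N : Matrix m m ℂ) (c : m → ℝ) (j : m) :
    (Nᴴ * diagonal (fun i => (c i : ℂ)) * N) j j =
      ((∑ i, Complex.normSq (N i j) * c i : ℝ) : ℂ) := by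
  rw [mul_apply]
  push_cast
  refine Finset.sum_congr rfl fun i _ => ?_
  rw [mul_diagonal, conjTranspose_apply, ← Complex.mul_conj]
  simp only [RCLike.star_def]
  ring

/-- One-shot bound on the success probability of a test `T`, for `ρ = S X S`. -/
lemma trace_mul_test_le {E X W T : Matrix m m ℂ} {μ x : m → ℝ} (hE : Eᴴ * E = 1)
    (hX : IsSpectral X W x) (hx : ∀ i, 0 ≤ x i) (hμ : ∀ i, 0 ≤ μ i) (hT : IsTest T)
    {p q : ℝ} (hpq : p.HolderConjugate q) :
    (conjDiag E μ * X * conjDiag E μ * T).trace.re ≤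
      (∑ i, x i ^ p) ^ (1 / p) *
        ((conjDiag E (fun i => μ i ^ (2 * q)) * T).trace.re) ^ (1 / q) := by
  obtain ⟨V, t, hV, ht⟩ := exists_isSpectral hT.1
  have hVV := hV.unitary
  set S := conjDiag E μ with hS
  set K := conjDiag V (fun i => √(t i)) with hK
  have hSH : Sᴴ = S := conjDiag_conjTranspose _ _
  have hKH : Kᴴ = K := conjDiag_conjTranspose _ _
  have hKK : K * K = T := by
    rw [hK, conjDiag_mul hVV, hV.eq]
    simp only [fun i => Real.mul_self_sqrt (ht i)]
    rfl
  have hY : (S * T * S).PosSemidef := by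
    have := hT.1.conjTranspose_mul_mul_same S
    rwa [hSH] at this
  have hG : (K * (S * S) * K).PosSemidef := by
    have : (S * S).PosSemidef := by
      have := posSemidef_conjTranspose_mul_self S
      rwa [hSH] at this
    have := this.conjTranspose_mul_mul_same K
    rwa [hKH] at this
  obtain ⟨U', y, hYs, hy⟩ := exists_isSpectral hY
  obtain ⟨U, g, hGs, hg⟩ := exists_isSpectral hG
  have hchar : (S * T * S).charpoly = (K * (S * S) * K).charpoly := by
    have : S * T * S = (S * K) * (K * S) := by rw [← hKK]; simp only [Matrix.mul_assoc]
    rw [this, charpoly_mul_comm]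
    simp only [Matrix.mul_assoc]
  have hyg : ∑ i, y i ^ q = ∑ i, g i ^ q :=
    hYs.sum_comp_eq_of_charpoly_eq hGs hchar (fun z => z ^ q)
  have h1 : (S * X * S * T).trace = (X * (S * T * S)).trace := by
    rw [Matrix.mul_assoc, Matrix.mul_assoc, trace_mul_comm]
    simp only [Matrix.mul_assoc]
  rw [h1]
  refine (trace_mul_le_holder hX hYs hx hy hpq).trans ?_
  have hq0 := hpq.symm.pos
  refine mul_le_mul_of_nonneg_left ?_
    (Real.rpow_nonneg (Finset.sum_nonneg fun i _ => Real.rpow_nonneg (hx i) _) _)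
  refine Real.rpow_le_rpow (Finset.sum_nonneg fun i _ => Real.rpow_nonneg (hy i) _) ?_
    (by positivity)
  rw [hyg]
  set N := Eᴴ * K * U with hN
  have hNH : Nᴴ = Uᴴ * K * E := by
    rw [hN]; simp only [conjTranspose_mul, conjTranspose_conjTranspose, hKH, Matrix.mul_assoc]
  have hg_eq : ∀ j, g j = ∑ i, Complex.normSq (N i j) * (μ i * μ i) := by
    intro j
    have e1 : Uᴴ * (K * (S * S) * K) * U = diagonal (fun i => (g i : ℂ)) := by
      calc _ = (Uᴴ * U) * diagonal (fun i => (g i : ℂ)) * (Uᴴ * U) := by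
            rw [hGs.eq]; simp only [Matrix.mul_assoc]
        _ = _ := by rw [hGs.unitary, Matrix.one_mul, Matrix.mul_one]
    have e2 : Uᴴ * (K * (S * S) * K) * U =
        Nᴴ * diagonal (fun i => ((μ i * μ i : ℝ) : ℂ)) * N := by
      rw [hS, conjDiag_mul hE, hNH, hN, conjDiag]; simp only [Matrix.mul_assoc]
    have e3 := conjTranspose_mul_diagonal_mul_diag N (fun i => μ i * μ i) j
    rw [← e2, e1, diagonal_apply_eq] at e3
    exact_mod_cast e3
  have hN1 : ∀ j, ∑ i, Complex.normSq (N i j) ≤ 1 := by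
    intro j
    have e1 : (Uᴴ * (1 - T) * U).PosSemidef := hT.2.conjTranspose_mul_mul_same U
    have e2 : Uᴴ * (1 - T) * U = 1 - Nᴴ * diagonal (fun _ => ((1 : ℝ) : ℂ)) * N := by
      have : Nᴴ * diagonal (fun _ : m => ((1 : ℝ) : ℂ)) * N = Uᴴ * T * U := by
        have hE' : E * Eᴴ = 1 := mul_eq_one_comm.mp hE
        have : diagonal (fun _ : m => ((1 : ℝ) : ℂ)) = 1 := by simp
        rw [this, Matrix.mul_one, hNH, hN]
        calc _ = Uᴴ * (K * (E * Eᴴ) * K) * U := by simp only [Matrix.mul_assoc]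
          _ = _ := by rw [hE', Matrix.mul_one, hKK]
      rw [this, Matrix.mul_sub, Matrix.sub_mul, Matrix.mul_one, hGs.unitary]
    have e3 := e1.diag_nonneg (i := j)
    rw [e2, Matrix.sub_apply, one_apply_eq, conjTranspose_mul_diagonal_mul_diag] at e3
    have := (Complex.nonneg_iff.mp e3).1
    simp only [mul_one, Complex.sub_re, Complex.one_re, Complex.ofReal_re] at this
    linarith
  have hjensen : ∀ j, g j ^ q ≤ ∑ i, Complex.normSq (N i j) * μ i ^ (2 * q) := by
    intro j
    have h := Real.inner_le_weight_mul_Lp_of_nonneg univ hpq.symm.lt.le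
      (fun i => Complex.normSq (N i j)) (fun i => μ i * μ i)
      (fun i => Complex.normSq_nonneg _) (fun i => mul_self_nonneg _)
    rw [← hg_eq] at h
    have hsum0 : 0 ≤ ∑ i, Complex.normSq (N i j) :=
      Finset.sum_nonneg fun i _ => Complex.normSq_nonneg _
    have h3 : (∑ i, Complex.normSq (N i j)) ^ (1 - q⁻¹) ≤ 1 :=
      Real.rpow_le_one hsum0 (hN1 j) (by
        have : q⁻¹ ≤ 1 := inv_le_one_of_one_le₀ hpq.symm.lt.le
        linarith)
    have hB0 : 0 ≤ ∑ i, Complex.normSq (N i j) * (μ i * μ i) ^ q :=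
      Finset.sum_nonneg fun i _ => mul_nonneg (Complex.normSq_nonneg _)
        (Real.rpow_nonneg (mul_self_nonneg _) _)
    have h4 : g j ≤ (∑ i, Complex.normSq (N i j) * (μ i * μ i) ^ q) ^ q⁻¹ :=
      h.trans (mul_le_of_le_one_left (Real.rpow_nonneg hB0 _) h3)
    calc g j ^ q ≤ ((∑ i, Complex.normSq (N i j) * (μ i * μ i) ^ q) ^ q⁻¹) ^ q :=
          Real.rpow_le_rpow (hg j) h4 hq0.le
      _ = ∑ i, Complex.normSq (N i j) * (μ i * μ i) ^ q := by
          rw [← Real.rpow_mul hB0, inv_mul_cancel₀ hq0.ne', Real.rpow_one]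
      _ = _ := by
          refine Finset.sum_congr rfl fun i _ => ?_
          rw [Real.mul_rpow (hμ i) (hμ i), ← Real.rpow_add_of_nonneg (hμ i) hq0.le hq0.le, two_mul]
  refine (Finset.sum_le_sum fun j _ => hjensen j).trans (le_of_eq ?_)
  have e1 : (conjDiag E (fun i => μ i ^ (2 * q)) * T).trace =
      (Nᴴ * diagonal (fun i => ((μ i ^ (2 * q) : ℝ) : ℂ)) * N).trace := by
    have : Nᴴ * diagonal (fun i => ((μ i ^ (2 * q) : ℝ) : ℂ)) * N =
        Uᴴ * (K * conjDiag E (fun i => μ i ^ (2 * q)) * K * U) := by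
      rw [hNH, hN, conjDiag]; simp only [Matrix.mul_assoc]
    rw [this, trace_mul_comm Uᴴ, Matrix.mul_assoc, hGs.unitary', Matrix.mul_one,
      trace_mul_comm (K * _), ← Matrix.mul_assoc, hKK, trace_mul_comm]
  rw [e1, trace]
  simp only [diag_apply, conjTranspose_mul_diagonal_mul_diag]
  rw [← Complex.ofReal_sum, Complex.ofReal_re]

end Converse

section Pinching

variable {ι K : Type*} [Fintype ι] [DecidableEq ι] [Fintype K] [DecidableEq K]

/-- The pinching of `R` by the partition of the index type given by `τ`. -/
noncomputable def pinch (τ : ι → K) (R : Matrix ι ι ℂ) : Matrix ι ι ℂ :=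
  Matrix.of fun x y => if τ x = τ y then R x y else 0

/-- The pinching inequality `R ≤ |K| • pinch τ R`. -/
lemma card_smul_pinch_sub_posSemidef (τ : ι → K) {R : Matrix ι ι ℂ} (hR : R.PosSemidef) :
    ((((Fintype.card K : ℝ)) : ℂ) • pinch τ R - R).PosSemidef := by
  let D : K → K → Matrix ι ι ℂ := fun s t =>
    diagonal fun x => (if τ x = s then 1 else 0) - (if τ x = t then 1 else 0)
  have hD : ∀ s t, (D s t)ᴴ = D s t := by
    intro s t
    simp only [D, diagonal_conjTranspose]
    congr 1
    ext x
    simp only [Pi.star_apply, star_sub]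
    split_ifs <;> simp
  have h1 : ((1 / 2 : ℂ) • ∑ s, ∑ t, D s t * R * D s t).PosSemidef := by
    refine PosSemidef.smul ?_ (by rw [Complex.nonneg_iff]; norm_num)
    refine posSemidef_sum _ fun s _ => posSemidef_sum _ fun t _ => ?_
    have := hR.conjTranspose_mul_mul_same (D s t)
    rwa [hD] at this
  convert h1 using 1
  ext x y
  simp only [Matrix.sub_apply, Matrix.smul_apply, Matrix.sum_apply, D, mul_diagonal, diagonal_mul, smul_eq_mul, pinch,
    of_apply]
  have : ∀ s t : K, ((if τ x = s then (1 : ℂ) else 0) - (if τ x = t then 1 else 0)) * R x y *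
      ((if τ y = s then 1 else 0) - (if τ y = t then 1 else 0)) =
      R x y * ((if τ x = s then (if τ y = s then 1 else 0) else 0)
        + (if τ x = t then (if τ y = t then 1 else 0) else 0)
        - (if τ x = s then (if τ y = t then 1 else 0) else 0)
        - (if τ x = t then (if τ y = s then 1 else 0) else 0)) := by
    intro s t
    split_ifs <;> ring
  simp only [this, ← Finset.mul_sum, Finset.sum_add_distrib, Finset.sum_sub_distrib,
    Finset.sum_ite_eq, Finset.sum_const, Finset.mem_univ, if_true, Finset.card_univ, nsmul_eq_mul]
  by_cases h : τ x = τ y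
  · simp [h]; ring
  · simp [h, Ne.symm h]; ring

/-- A pinched positive semidefinite matrix is diagonalized by a unitary respecting the partition. -/
lemma exists_unitary_pinch (τ : ι → K) {R : Matrix ι ι ℂ} (hR : R.PosSemidef) :
    ∃ (W : Matrix ι ι ℂ) (p : ι → ℝ), IsSpectral (pinch τ R) W p ∧ (∀ i, 0 ≤ p i) ∧
      ∀ x y, τ x ≠ τ y → W x y = 0 := by
  let B : (k : K) → Matrix {x // τ x = k} {x // τ x = k} ℂ := fun k => R.submatrix (↑) (↑)
  have hB : ∀ k, (B k).PosSemidef := fun k => hR.submatrix _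
  choose U a hU ha using fun k => exists_isSpectral (hB k)
  let e := (Equiv.sigmaFiberEquiv τ).symm
  refine ⟨(blockDiagonal' U).submatrix e e, fun x => a (e x).1 (e x).2, ⟨?_, ?_⟩,
    fun i => ha _ _, ?_⟩
  · rw [conjTranspose_submatrix, submatrix_mul_equiv, blockDiagonal'_conjTranspose,
      ← blockDiagonal'_mul]
    simp only [fun k => (hU k).unitary]
    have : (blockDiagonal' fun k : K => (1 : Matrix {x // τ x = k} {x // τ x = k} ℂ)) = 1 :=
      blockDiagonal'_one
    rw [this, submatrix_one_equiv]
  · have h1 : pinch τ R = (blockDiagonal' B).submatrix e e := by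
      ext x y
      simp only [pinch, of_apply, submatrix_apply, blockDiagonal'_apply]
      by_cases h : τ x = τ y
      · rw [if_pos h, dif_pos (show (e x).1 = (e y).1 from h)]
        have : ∀ (z : {z // τ z = τ x}) , z.1 = y → R x y = B (τ x) ⟨x, rfl⟩ z := by
          rintro z rfl; rfl
        refine this _ ?_
        have h2 : ∀ (k : K) (hk : τ y = k), (cast (congrArg (fun k => {z // τ z = k}) hk)
            (⟨y, rfl⟩ : {z // τ z = τ y})).1 = y := by
          rintro k rfl; rfl
        exact h2 _ h.symm
      · rw [if_neg h, dif_neg (show ¬ (e x).1 = (e y).1 from h)]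
    have h2 : (diagonal fun x => ((a (e x).1 (e x).2 : ℝ) : ℂ)) =
        (blockDiagonal' fun k => diagonal fun i => ((a k i : ℝ) : ℂ)).submatrix e e := by
      rw [blockDiagonal'_diagonal, submatrix_diagonal_equiv]
      rfl
    rw [h1, h2, conjTranspose_submatrix, submatrix_mul_equiv, submatrix_mul_equiv,
      blockDiagonal'_conjTranspose, ← blockDiagonal'_mul, ← blockDiagonal'_mul]
    congr 2
    ext1 k
    exact (hU k).eq
  · intro x y h
    rw [submatrix_apply, blockDiagonal'_apply, dif_neg (show ¬ (e x).1 = (e y).1 from h)]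

end Pinching

end QRD

namespace QRD

open Matrix Finset

section Sandwiched

variable {X : Type*} [Fintype X] [DecidableEq X]

/-- The matrix `σ^{(1−α)/(2α)} ρ σ^{(1−α)/(2α)}`. -/
noncomputable def sandwich (α : ℝ) (ρ σ : Matrix X X ℂ) : Matrix X X ℂ :=
  matPow σ ((1 - α) / (2 * α)) * ρ * matPow σ ((1 - α) / (2 * α))

/-- The real number underlying `Qstar` when the supports are compatible. -/
noncomputable def qReal (α : ℝ) (ρ σ : Matrix X X ℂ) : ℝ :=
  (matPow (sandwich α ρ σ) α).trace.re

lemma IsSpectral.matPow_eq {A W : Matrix X X ℂ} {a : X → ℝ} (h : IsSpectral A W a) {t : ℝ}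
    (ht : t ≠ 0) : matPow A t = conjDiag W (fun i => a i ^ t) := by
  rw [matPow, h.matFun_eq]
  congr 1
  ext i
  split_ifs with h0
  · rw [h0, Real.zero_rpow ht]
  · rfl

lemma qReal_eq_sum {α : ℝ} (hα : 1 < α) {ρ σ W : Matrix X X ℂ} {x : X → ℝ}
    (h : IsSpectral (sandwich α ρ σ) W x) : qReal α ρ σ = ∑ i, x i ^ α := by
  rw [qReal, h.matPow_eq (by linarith), trace_conjDiag h.unitary, Complex.ofReal_re]

lemma sandwich_eq {α : ℝ} (hα : 1 < α) {ρ σ U : Matrix X X ℂ} {l : X → ℝ}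
    (h : IsSpectral σ U l) :
    sandwich α ρ σ = conjDiag U (fun i => l i ^ ((1 - α) / (2 * α))) * ρ *
      conjDiag U (fun i => l i ^ ((1 - α) / (2 * α))) := by
  rw [sandwich, h.matPow_eq]
  exact div_ne_zero (by linarith) (by linarith)

lemma sandwich_posSemidef {α : ℝ} (hα : 1 < α) {ρ σ : Matrix X X ℂ} (hρ : ρ.PosSemidef)
    (hσ : σ.PosSemidef) : (sandwich α ρ σ).PosSemidef := by
  obtain ⟨U, l, h, -⟩ := exists_isSpectral hσ
  rw [sandwich_eq hα h]
  have := hρ.conjTranspose_mul_mul_same (conjDiag U (fun i => l i ^ ((1 - α) / (2 * α))))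
  rwa [conjDiag_conjTranspose] at this

lemma conjDiag_mul_sandwich_mul_conjDiag {α : ℝ} (hα : 1 < α) {ρ σ U : Matrix X X ℂ} {l : X → ℝ}
    (hρ : ρ.PosSemidef) (h : IsSpectral σ U l) (hl : ∀ i, 0 ≤ l i) (hs : suppLE ρ σ) :
    conjDiag U (fun i => l i ^ ((α - 1) / (2 * α))) * sandwich α ρ σ *
      conjDiag U (fun i => l i ^ ((α - 1) / (2 * α))) = ρ := by
  set P := conjDiag U (fun i => if l i = 0 then 0 else 1) with hP
  have hs0 : (α - 1) / (2 * α) ≠ 0 := (div_pos (by linarith) (by linarith)).ne'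
  have hneg : (1 - α) / (2 * α) = -((α - 1) / (2 * α)) := by ring
  have hmul : ∀ i, l i ^ ((α - 1) / (2 * α)) * l i ^ ((1 - α) / (2 * α)) =
      if l i = 0 then 0 else 1 := by
    intro i
    split_ifs with h0
    · rw [h0, Real.zero_rpow hs0, zero_mul]
    · rw [hneg, ← Real.rpow_add (lt_of_le_of_ne (hl i) (Ne.symm h0)), add_neg_cancel,
        Real.rpow_zero]
  have hσP : σ * (1 - P) = 0 := by
    have h1 : σ = conjDiag U l := h.eq
    rw [Matrix.mul_sub, Matrix.mul_one, h1, hP, conjDiag_mul h.unitary, sub_eq_zero]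
    congr 1
    ext i
    split_ifs with h0 <;> simp [h0]
  have hρP : ρ * P = ρ := by
    have : ρ * (1 - P) = 0 := by
      ext i j
      have hk : (1 - P).col j ∈ LinearMap.ker σ.mulVecLin := by
        rw [LinearMap.mem_ker, mulVecLin_apply]
        ext k
        exact congrFun (congrFun hσP k) j
      have := hs hk
      rw [LinearMap.mem_ker, mulVecLin_apply] at this
      exact congrFun this i
    rw [Matrix.mul_sub, Matrix.mul_one, sub_eq_zero] at this
    exact this.symm
  have hPρ : P * ρ = ρ := by
    have := congrArg conjTranspose hρP
    rwa [conjTranspose_mul, hP, conjDiag_conjTranspose, hρ.1.eq] at this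
  rw [sandwich_eq hα h]
  calc _ = (conjDiag U (fun i => l i ^ ((α - 1) / (2 * α))) *
        conjDiag U (fun i => l i ^ ((1 - α) / (2 * α)))) * ρ *
        (conjDiag U (fun i => l i ^ ((1 - α) / (2 * α))) *
        conjDiag U (fun i => l i ^ ((α - 1) / (2 * α)))) := by simp only [Matrix.mul_assoc]
    _ = P * ρ * P := by
        rw [conjDiag_mul h.unitary, conjDiag_mul h.unitary]
        simp only [fun i => mul_comm (l i ^ ((1 - α) / (2 * α))), hmul]
        rfl
    _ = ρ := by rw [hPρ, hρP]

lemma qReal_nonneg {α : ℝ} (hα : 1 < α) {ρ σ : Matrix X X ℂ} (hρ : ρ.PosSemidef)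
    (hσ : σ.PosSemidef) : 0 ≤ qReal α ρ σ := by
  obtain ⟨W, x, hX, hx⟩ := exists_isSpectral (sandwich_posSemidef hα hρ hσ)
  rw [qReal_eq_sum hα hX]
  exact Finset.sum_nonneg fun i _ => Real.rpow_nonneg (hx i) _

variable (κ : Type*) [Fintype κ] [DecidableEq κ]

/-- The strong converse bound for tests on tensor powers. -/
lemma trace_tp_mul_test_le {α : ℝ} (hα : 1 < α) {ρ σ : Matrix X X ℂ} (hρ : ρ.PosSemidef)
    (hσ : σ.PosSemidef) (hs : suppLE ρ σ) {T : Matrix (κ → X) (κ → X) ℂ} (hT : IsTest T) :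
    (tp κ ρ * T).trace.re ≤ (qReal α ρ σ ^ Fintype.card κ) ^ (1 / α) *
      ((tp κ σ * T).trace.re) ^ ((α - 1) / α) := by
  obtain ⟨U, l, hU, hl⟩ := exists_isSpectral hσ
  obtain ⟨W, x, hX, hx⟩ := exists_isSpectral (sandwich_posSemidef hα hρ hσ)
  have hpq : α.HolderConjugate (α / (α - 1)) := Real.HolderConjugate.conjExponent hα
  have h1 := trace_mul_test_le (tp_unitary κ hU.unitary) (hX.tp κ)
    (fun y => Finset.prod_nonneg fun i _ => hx (y i))
    (μ := fun y => ∏ i, l (y i) ^ ((α - 1) / (2 * α)))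
    (fun y => Finset.prod_nonneg fun i _ => Real.rpow_nonneg (hl _) _) hT hpq
  rw [← tp_conjDiag κ U (fun i => l i ^ ((α - 1) / (2 * α))), ← tp_mul, ← tp_mul,
    conjDiag_mul_sandwich_mul_conjDiag hα hρ hU hl hs] at h1
  have h2 : (fun y : κ → X => (∏ i, l (y i) ^ ((α - 1) / (2 * α))) ^ (2 * (α / (α - 1)))) =
      fun y => ∏ i, l (y i) := by
    ext y
    rw [Real.finsetProd_rpow _ _ fun i _ => hl _,
      ← Real.rpow_mul (Finset.prod_nonneg fun i _ => hl _)]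
    have : (α - 1) / (2 * α) * (2 * (α / (α - 1))) = 1 := by
      have : α - 1 ≠ 0 := by linarith
      field_simp
    rw [this, Real.rpow_one]
  have h3 : ∑ y : κ → X, (∏ i, x (y i)) ^ α = qReal α ρ σ ^ Fintype.card κ := by
    rw [qReal_eq_sum hα hX, ← Finset.card_univ, ← Finset.prod_const, Fintype.prod_sum]
    exact Finset.sum_congr rfl fun y _ => (Real.finsetProd_rpow _ _ (fun i _ => hx _) _).symm
  rw [h2, ← tp_conjDiag, h3, one_div_div] at h1
  exact h1.trans_eq (by rw [hU.eq]; rfl)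

/-- Pinching a tensor power: a measurement in an eigenbasis of `σ^{⊗κ}` that preserves `qReal`
up to a polynomial factor. -/
lemma exists_eigenbasis_measurement {ρ σ : Matrix X X ℂ} (hρ : ρ.PosSemidef)
    (hσ : σ.PosSemidef) :
    ∃ (V : Matrix (κ → X) (κ → X) ℂ) (p q : (κ → X) → ℝ), IsSpectral (tp κ σ) V q ∧
      (∀ x, (Vᴴ * tp κ ρ * V) x x = p x) ∧ (∀ x, 0 ≤ p x) ∧ (∀ x, 0 ≤ q x) ∧
      ∀ α, 1 < α → qReal α ρ σ ^ Fintype.card κ ≤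
        (((Fintype.card κ + 1) ^ Fintype.card X : ℕ) : ℝ) ^ α * ∑ x, p x ^ α * q x ^ (1 - α) := by
  obtain ⟨U, l, hU, hl⟩ := exists_isSpectral hσ
  set E := tp κ U with hE
  have hEu : Eᴴ * E = 1 := tp_unitary κ hU.unitary
  have hEu' : E * Eᴴ = 1 := mul_eq_one_comm.mp hEu
  let τ : (κ → X) → X → Fin (Fintype.card κ + 1) := fun x a =>
    ⟨#{i | x i = a}, Nat.lt_succ_of_le (Finset.card_le_univ _)⟩
  let q : (κ → X) → ℝ := fun x => ∏ i, l (x i)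
  have hq0 : ∀ x, 0 ≤ q x := fun x => Finset.prod_nonneg fun i _ => hl _
  have hqτ : ∀ x y, τ x = τ y → q x = q y := by
    have : ∀ x, q x = ∏ a, l a ^ (τ x a : ℕ) := fun x => by
      simp only [q, τ]
      rw [← Finset.prod_fiberwise univ x (fun i => l (x i))]
      refine Finset.prod_congr rfl fun a _ => ?_
      rw [Finset.prod_congr rfl (g := fun _ => l a), Finset.prod_const]
      intro i hi
      rw [(Finset.mem_filter.mp hi).2]
    intro x y h
    rw [this, this, h]
  set R := Eᴴ * tp κ ρ * E with hR
  have hRp : R.PosSemidef := (tp_posSemidef κ hρ).conjTranspose_mul_mul_same E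
  obtain ⟨W, p, hW, hp0, hW0⟩ := exists_unitary_pinch τ hRp
  have hcomm : ∀ f : ℝ → ℝ, diagonal (fun x => ((f (q x) : ℝ) : ℂ)) * W =
      W * diagonal (fun x => ((f (q x) : ℝ) : ℂ)) := by
    intro f
    ext x y
    rw [diagonal_mul, mul_diagonal]
    by_cases h : τ x = τ y
    · rw [hqτ x y h, mul_comm]
    · rw [hW0 x y h, mul_zero, zero_mul]
  refine ⟨E * W, p, q, ⟨?_, ?_⟩, ?_, hp0, hq0, ?_⟩
  · rw [conjTranspose_mul]
    calc _ = Wᴴ * (Eᴴ * E) * W := by simp only [Matrix.mul_assoc]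
      _ = 1 := by rw [hEu, Matrix.mul_one, hW.unitary]
  · rw [(hU.tp κ).eq, conjTranspose_mul]
    calc _ = E * diagonal (fun x => ((q x : ℝ) : ℂ)) * (W * Wᴴ) * Eᴴ := by
          rw [hW.unitary', Matrix.mul_one]
      _ = E * (diagonal (fun x => ((q x : ℝ) : ℂ)) * W) * Wᴴ * Eᴴ := by
          simp only [Matrix.mul_assoc]
      _ = _ := by rw [hcomm (fun z => z)]; simp only [Matrix.mul_assoc]
  · intro x
    have h1 : (E * W)ᴴ * tp κ ρ * (E * W) = Wᴴ * R * W := by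
      rw [conjTranspose_mul, hR]; simp only [Matrix.mul_assoc]
    have h2 : Wᴴ * pinch τ R * W = diagonal (fun i => (p i : ℂ)) := by
      calc _ = (Wᴴ * W) * diagonal (fun i => (p i : ℂ)) * (Wᴴ * W) := by
            rw [hW.eq]; simp only [Matrix.mul_assoc]
        _ = _ := by rw [hW.unitary, Matrix.one_mul, Matrix.mul_one]
    have h3 : (Wᴴ * R * W) x x = (Wᴴ * pinch τ R * W) x x := by
      simp only [mul_apply, pinch, of_apply, Finset.sum_mul, conjTranspose_apply]
      refine Finset.sum_congr rfl fun y _ => Finset.sum_congr rfl fun z _ => ?_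
      by_cases hy : τ y = τ x
      · by_cases hz : τ z = τ x
        · rw [if_pos (hz.trans hy.symm)]
        · rw [hW0 z x hz]; simp
      · rw [hW0 y x hy]; simp
    rw [h1, h3, h2, diagonal_apply_eq]
  · intro α hα
    obtain ⟨Wx, x, hX, hx⟩ := exists_isSpectral (sandwich_posSemidef hα hρ hσ)
    set s := (1 - α) / (2 * α) with hs
    set D : Matrix (κ → X) (κ → X) ℂ := diagonal (fun x => ((q x ^ s : ℝ) : ℂ)) with hD
    have hDH : Dᴴ = D := by
      rw [hD, diagonal_conjTranspose]; congr 1; ext i; simp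
    have hDW : D * W = W * D := hcomm (fun z => z ^ s)
    have hDW' : Wᴴ * D = D * Wᴴ := by
      have := congrArg conjTranspose hDW
      rwa [conjTranspose_mul, conjTranspose_mul, hDH] at this
    have hSm : tp κ (conjDiag U fun i => l i ^ s) = E * D * Eᴴ := by
      rw [tp_conjDiag, conjDiag, hD]
      simp only [fun y : κ → X => Real.finsetProd_rpow univ (fun i => l (y i))
        (fun i _ => hl _) s]
      rfl
    have hA : IsSpectral (D * R * D) (Eᴴ * tp κ Wx) (fun y => ∏ i, x (y i)) := by
      refine ⟨?_, ?_⟩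
      · rw [conjTranspose_mul, conjTranspose_conjTranspose]
        calc _ = (tp κ Wx)ᴴ * (E * Eᴴ) * tp κ Wx := by simp only [Matrix.mul_assoc]
          _ = 1 := by rw [hEu', Matrix.mul_one, (hX.tp κ).unitary]
      · have h1 : tp κ (sandwich α ρ σ) = E * D * Eᴴ * tp κ ρ * (E * D * Eᴴ) := by
          rw [sandwich_eq hα hU, tp_mul, tp_mul, hSm]
        calc _ = (Eᴴ * E) * D * Eᴴ * tp κ ρ * E * D * (Eᴴ * E) := by
              rw [hEu, Matrix.one_mul, Matrix.mul_one, hR]; simp only [Matrix.mul_assoc]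
          _ = Eᴴ * tp κ (sandwich α ρ σ) * E := by rw [h1]; simp only [Matrix.mul_assoc]
          _ = _ := by
              rw [(hX.tp κ).eq, conjTranspose_mul, conjTranspose_conjTranspose]
              simp only [Matrix.mul_assoc]
    have hB : IsSpectral (D * pinch τ R * D) W (fun y => q y ^ s * p y * q y ^ s) := by
      refine ⟨hW.unitary, ?_⟩
      rw [hW.eq]
      calc _ = (D * W) * diagonal (fun i => (p i : ℂ)) * (Wᴴ * D) := by
            simp only [Matrix.mul_assoc]
        _ = W * (D * diagonal (fun i => (p i : ℂ)) * D) * Wᴴ := by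
            rw [hDW, hDW']; simp only [Matrix.mul_assoc]
        _ = _ := by
            rw [hD, diagonal_mul_diagonal, diagonal_mul_diagonal]
            push_cast
            rfl
    have hle : (((Fintype.card (X → Fin (Fintype.card κ + 1)) : ℝ) : ℂ) • (D * pinch τ R * D)
        - D * R * D).PosSemidef := by
      have := (card_smul_pinch_sub_posSemidef τ hRp).conjTranspose_mul_mul_same D
      rwa [hDH, Matrix.mul_sub, Matrix.sub_mul, Matrix.mul_smul, Matrix.smul_mul] at this
    have h1 := sum_rpow_le_of_sub_posSemidef hA hB
      (fun y => Finset.prod_nonneg fun i _ => hx _)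
      (fun y => mul_nonneg (mul_nonneg (Real.rpow_nonneg (hq0 y) _) (hp0 y))
        (Real.rpow_nonneg (hq0 y) _)) (Nat.cast_nonneg _) hle hα
    have h3 : ∑ y : κ → X, (∏ i, x (y i)) ^ α = qReal α ρ σ ^ Fintype.card κ := by
      rw [qReal_eq_sum hα hX, ← Finset.card_univ, ← Finset.prod_const, Fintype.prod_sum]
      exact Finset.sum_congr rfl fun y _ => (Real.finsetProd_rpow _ _ (fun i _ => hx _) _).symm
    have h4 : ∀ y, (q y ^ s * p y * q y ^ s) ^ α = p y ^ α * q y ^ (1 - α) := by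
      intro y
      have hqs := Real.rpow_nonneg (hq0 y) s
      rw [Real.mul_rpow (mul_nonneg hqs (hp0 y)) hqs, Real.mul_rpow hqs (hp0 y),
        ← Real.rpow_mul (hq0 y)]
      have : s * α = (1 - α) / 2 := by
        rw [hs]; field_simp
      rw [this]
      have h5 : q y ^ ((1 - α) / 2) * q y ^ ((1 - α) / 2) = q y ^ (1 - α) := by
        rcases (hq0 y).eq_or_lt with h | h
        · rw [← h, Real.zero_rpow (by linarith), Real.zero_rpow (by linarith), zero_mul]
        · rw [← Real.rpow_add h, add_halves]
      rw [← h5]; ring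
    rw [h3] at h1
    simp only [h4] at h1
    rwa [Fintype.card_fun, Fintype.card_fin] at h1

end Sandwiched

end QRD

namespace QRD

open Finset

section ClassicalTests

variable {Y : Type*} [Fintype Y]

lemma sum_prod_succ {k : ℕ} (f : Y → ℝ) (h : (Fin (k + 1) → Y) → ℝ) :
    ∑ x : Fin (k + 1) → Y, (∏ i, f (x i)) * h x =
      ∑ y, ∑ x : Fin k → Y, (f y * ∏ i, f (x i)) * h (Fin.cons y x) := by
  rw [← Fintype.sum_prod_type', ← (Fin.consEquiv fun _ => Y).sum_comp]
  refine Finset.sum_congr rfl fun z _ => ?_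
  simp [Fin.consEquiv, Fin.prod_univ_succ]

lemma sum_prod_eq_one {w : Y → ℝ} (hw : ∑ y, w y = 1) (k : ℕ) :
    ∑ x : Fin k → Y, ∏ i, w (x i) = 1 := by
  rw [← Fintype.sum_pow, hw, one_pow]

lemma sum_prod_mul_sum_eq_zero {w g : Y → ℝ} (hw : ∑ y, w y = 1) (hg : ∑ y, w y * g y = 0)
    (k : ℕ) : ∑ x : Fin k → Y, (∏ i, w (x i)) * ∑ i, g (x i) = 0 := by
  induction k with
  | zero => simp
  | succ k ih =>
    rw [sum_prod_succ]
    have h1 : ∀ y, ∑ x : Fin k → Y, (w y * ∏ i, w (x i)) * ∑ i, g ((Fin.cons y x :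
        Fin (k + 1) → Y) i) = w y * g y := by
      intro y
      simp only [Fin.sum_univ_succ, Fin.cons_zero, Fin.cons_succ, mul_add, Finset.sum_add_distrib,
        mul_assoc, ← Finset.mul_sum]
      rw [ih, mul_zero, add_zero, ← Finset.sum_mul, sum_prod_eq_one hw, one_mul]
    simp only [h1, hg]

/-- The second moment of a sum of centred i.i.d. variables. -/
lemma sum_prod_mul_sum_sq {w g : Y → ℝ} (hw : ∑ y, w y = 1) (hg : ∑ y, w y * g y = 0)
    (k : ℕ) : ∑ x : Fin k → Y, (∏ i, w (x i)) * (∑ i, g (x i)) ^ 2 =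
      k * ∑ y, w y * g y ^ 2 := by
  induction k with
  | zero => simp
  | succ k ih =>
    rw [sum_prod_succ]
    have h1 : ∀ y, ∑ x : Fin k → Y, (w y * ∏ i, w (x i)) * (∑ i, g ((Fin.cons y x :
        Fin (k + 1) → Y) i)) ^ 2 = w y * g y ^ 2 + w y * (k * ∑ y, w y * g y ^ 2) := by
      intro y
      have h2 : ∀ x : Fin k → Y, (w y * ∏ i, w (x i)) * (∑ i, g ((Fin.cons y x :
          Fin (k + 1) → Y) i)) ^ 2 = w y * g y ^ 2 * (∏ i, w (x i)) +
          2 * w y * g y * ((∏ i, w (x i)) * ∑ i, g (x i)) +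
          w y * ((∏ i, w (x i)) * (∑ i, g (x i)) ^ 2) := by
        intro x
        simp only [Fin.sum_univ_succ, Fin.cons_zero, Fin.cons_succ]
        ring
      simp only [h2, Finset.sum_add_distrib, ← Finset.mul_sum]
      rw [ih, sum_prod_eq_one hw, sum_prod_mul_sum_eq_zero hw hg]
      ring
    simp only [h1, Finset.sum_add_distrib, ← Finset.sum_mul, hw]
    push_cast
    ring

/-- The weak law of large numbers for a finitely supported distribution. -/
lemma eventually_half_le_sum_typical {w g : Y → ℝ} (hw0 : ∀ y, 0 ≤ w y) (hw : ∑ y, w y = 1)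
    {δ : ℝ} (hδ : 0 < δ) :
    ∀ᶠ k : ℕ in Filter.atTop, 1 / 2 ≤ ∑ x : Fin k → Y,
      if |∑ i, g (x i) - k * ∑ y, w y * g y| ≤ k * δ then ∏ i, w (x i) else 0 := by
  set l := ∑ y, w y * g y with hl
  set v := ∑ y, w y * (g y - l) ^ 2 with hv
  have hv0 : 0 ≤ v := Finset.sum_nonneg fun y _ => mul_nonneg (hw0 y) (sq_nonneg _)
  have hcent : ∑ y, w y * (g y - l) = 0 := by
    simp only [mul_sub, Finset.sum_sub_distrib, ← Finset.sum_mul, hw, hl]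
    ring
  obtain ⟨k₀, hk₀⟩ := exists_nat_gt (2 * v / δ ^ 2)
  filter_upwards [Filter.eventually_ge_atTop (k₀ + 1)] with k hk
  have hk1 : (0 : ℝ) < k := by exact_mod_cast (by omega : 0 < k)
  have hk2 : 2 * v ≤ k * δ ^ 2 := by
    have : 2 * v / δ ^ 2 < k := hk₀.trans_le (by exact_mod_cast (by omega : k₀ ≤ k))
    exact ((div_lt_iff₀ (by positivity)).mp this).le
  have hsum : ∀ x : Fin k → Y, ∑ i, (g (x i) - l) = ∑ i, g (x i) - k * l := by
    intro x; simp
  have hle : ∀ x : Fin k → Y, (∏ i, w (x i)) -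
      (if |∑ i, g (x i) - k * l| ≤ k * δ then ∏ i, w (x i) else 0) ≤
      ((k * δ) ^ 2)⁻¹ * ((∏ i, w (x i)) * (∑ i, (g (x i) - l)) ^ 2) := by
    intro x
    have hW : 0 ≤ ∏ i, w (x i) := Finset.prod_nonneg fun i _ => hw0 _
    split_ifs with h
    · rw [sub_self]; positivity
    · rw [sub_zero, hsum]
      have h1 : (k * δ) ^ 2 ≤ (∑ i, g (x i) - k * l) ^ 2 := by
        rw [← sq_abs (∑ i, g (x i) - k * l)]
        exact pow_le_pow_left₀ (by positivity) (not_le.mp h).le 2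
      have h2 : 1 ≤ ((k * δ) ^ 2)⁻¹ * (∑ i, g (x i) - k * l) ^ 2 := by
        rw [← div_eq_inv_mul, one_le_div (by positivity)]
        exact h1
      nlinarith
  have h3 := Finset.sum_le_sum fun x (_ : x ∈ (univ : Finset (Fin k → Y))) => hle x
  rw [Finset.sum_sub_distrib, sum_prod_eq_one hw, ← Finset.mul_sum,
    sum_prod_mul_sum_sq hw hcent] at h3
  have h4 : ((k * δ) ^ 2)⁻¹ * (k * v) ≤ 1 / 2 := by
    rw [← div_eq_inv_mul, div_le_iff₀ (by positivity)]
    nlinarith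
  linarith

/-- The exponent balancing step: choosing the tilting parameter by continuity. -/
lemma exists_tilt {F G : ℝ → ℝ} {C M : ℝ} (hF : Continuous F) (hG : Continuous G)
    (hM : ∀ α, 1 ≤ α → G α ≤ M) (h : ∀ α, 1 < α → F α + (α - 1) / α * G α ≤ C) {δ : ℝ}
    (hδ : 0 < δ) : ∃ α, 1 ≤ α ∧ F α ≤ C + δ ∧ F α + G α ≤ C + δ := by
  have h1 : F 1 ≤ C := by
    have hc : Filter.Tendsto (fun α => F α + (α - 1) / α * G α) (nhdsWithin 1 (Set.Ioi 1))
        (nhds (F 1 + (1 - 1) / 1 * G 1)) := by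
      have : ContinuousAt (fun α : ℝ => F α + (α - 1) / α * G α) 1 := by
        refine hF.continuousAt.add (ContinuousAt.mul ?_ hG.continuousAt)
        exact ContinuousAt.div (by fun_prop) (by fun_prop) one_ne_zero
      exact this.tendsto.mono_left nhdsWithin_le_nhds
    have := le_of_tendsto hc (Filter.eventually_of_mem self_mem_nhdsWithin fun α hα => h α hα)
    simpa using this
  have h' : ∀ α, 1 ≤ α → F α + (α - 1) / α * G α ≤ C := by
    intro α hα
    rcases hα.eq_or_lt with rfl | hα
    · simpa using h1
    · exact h α hα
  by_cases hG1 : G 1 ≤ 0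
  · exact ⟨1, le_rfl, by linarith, by linarith⟩
  by_cases hex : ∃ α, 1 < α ∧ G α ≤ 0
  · obtain ⟨α, hα, hGα⟩ := hex
    obtain ⟨β, hβ, hβ0⟩ := intermediate_value_Icc' hα.le hG.continuousOn
      (show (0 : ℝ) ∈ Set.Icc (G α) (G 1) from ⟨hGα, (not_le.mp hG1).le⟩)
    have := h' β hβ.1
    rw [hβ0, mul_zero, add_zero] at this
    exact ⟨β, hβ.1, by linarith, by linarith⟩
  · push Not at hex
    have hM0 : 0 < M := (not_le.mp hG1).trans_le (hM 1 le_rfl)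
    set α := 1 + M / δ with hα
    have hα1 : 1 < α := by rw [hα]; have := div_pos hM0 hδ; linarith
    have hα0 : 0 < α := by linarith
    have hGα := hex α hα1
    have hh := h α hα1
    have hs : 0 ≤ (α - 1) / α * G α := mul_nonneg (div_nonneg (by linarith) hα0.le) hGα.le
    refine ⟨α, hα1.le, by linarith, ?_⟩
    have e : (α - 1) / α * G α = G α - G α / α := by field_simp
    have h2 : G α / α ≤ δ := by
      rw [div_le_iff₀ hα0, hα]
      have := hM α hα1.le
      have : δ * (1 + M / δ) = δ + M := by field_simp
      linarith
    linarith

/-- Achievability of the strong converse exponent for finite distributions `p = q exp(L)`. -/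
lemma eventually_exists_test_of_exp {q L : Y → ℝ} (hq : ∀ y, 0 ≤ q y) (hq1 : ∑ y, q y ≤ 1)
    (hp1 : ∑ y, q y * Real.exp (L y) = 1) {R C : ℝ}
    (h : ∀ α, 1 < α →
      (α - 1) / α * R - 1 / α * Real.log (∑ y, q y * Real.exp (α * L y)) ≤ C)
    {ε : ℝ} (hε : 0 < ε) :
    ∀ᶠ k : ℕ in Filter.atTop, ∃ t : (Fin k → Y) → ℝ, (∀ x, 0 ≤ t x ∧ t x ≤ 1) ∧
      ∑ x, (∏ i, q (x i)) * t x ≤ Real.exp (-(k * R)) ∧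
      Real.exp (-(k * (C + ε))) ≤ ∑ x, (∏ i, q (x i) * Real.exp (L (x i))) * t x := by
  set Z : ℝ → ℝ := fun α => ∑ y, q y * Real.exp (α * L y) with hZ
  have hZpos : ∀ α, 0 < Z α := by
    intro α
    obtain ⟨y, -, hy⟩ : ∃ y ∈ univ, 0 < q y * Real.exp (L y) :=
      Finset.exists_lt_of_sum_lt (by simpa using hp1 ▸ one_pos)
    have hy' : 0 < q y := pos_of_mul_pos_left hy (Real.exp_pos _).le
    exact Finset.sum_pos' (fun y _ => mul_nonneg (hq y) (Real.exp_pos _).le)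
      ⟨y, mem_univ y, mul_pos hy' (Real.exp_pos _)⟩
  have hZc : Continuous Z := by fun_prop
  set w : ℝ → Y → ℝ := fun α y => q y * Real.exp (α * L y) / Z α with hw
  have hw0 : ∀ α y, 0 ≤ w α y := fun α y =>
    div_nonneg (mul_nonneg (hq y) (Real.exp_pos _).le) (hZpos α).le
  have hw1 : ∀ α, ∑ y, w α y = 1 := fun α => by
    rw [hw, ← Finset.sum_div]; exact div_self (hZpos α).ne'
  set l : ℝ → ℝ := fun α => ∑ y, w α y * L y with hl
  have hlc : Continuous l := by
    refine continuous_finsetSum _ fun y _ => Continuous.mul ?_ continuous_const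
    exact Continuous.div (by fun_prop) hZc fun α => (hZpos α).ne'
  have hlogZ : Continuous fun α => Real.log (Z α) := hZc.log fun α => (hZpos α).ne'
  have hqw : ∀ α y, q y = w α y * Real.exp (-(α * L y - Real.log (Z α))) := by
    intro α y
    rw [neg_sub, Real.exp_sub, Real.exp_log (hZpos α), hw]
    have := (hZpos α).ne'
    field_simp
  have hpw : ∀ α y, q y * Real.exp (L y) =
      w α y * Real.exp (-((α - 1) * L y - Real.log (Z α))) := by
    intro α y
    rw [hqw α y, mul_assoc, ← Real.exp_add]
    congr 2; ring
  have hDb : ∀ α, 0 ≤ α * l α - Real.log (Z α) := by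
    intro α
    have h1 : ∑ y, w α y * (1 - (α * L y - Real.log (Z α))) ≤ ∑ y, q y := by
      refine Finset.sum_le_sum fun y _ => ?_
      refine le_of_le_of_eq (mul_le_mul_of_nonneg_left ?_ (hw0 α y)) (hqw α y).symm
      have := Real.add_one_le_exp (-(α * L y - Real.log (Z α)))
      linarith
    have h2 : ∑ y, w α y * (1 - (α * L y - Real.log (Z α))) =
        1 - (α * l α - Real.log (Z α)) := by
      have : ∀ y, w α y * (1 - (α * L y - Real.log (Z α))) =
          w α y * (1 + Real.log (Z α)) - α * (w α y * L y) := fun y => by ring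
      simp only [this, Finset.sum_sub_distrib, ← Finset.sum_mul, ← Finset.mul_sum, hw1]
      ring
    linarith
  obtain ⟨α, hα, hF, hFG⟩ := exists_tilt (C := C) (M := R)
    (F := fun α => (α - 1) * l α - Real.log (Z α))
    (G := fun α => R - (α * l α - Real.log (Z α))) (by fun_prop) (by fun_prop)
    (fun α _ => by have := hDb α; linarith)
    (fun α hα => by
      have hα0 : α ≠ 0 := by linarith
      have e : (α - 1) * l α - Real.log (Z α) +
          (α - 1) / α * (R - (α * l α - Real.log (Z α))) =
          (α - 1) / α * R - 1 / α * Real.log (Z α) := by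
        field_simp; ring
      rw [e]
      exact h α hα) (show 0 < ε / 4 by positivity)
  have hα0 : 0 < α := by linarith
  set δ := ε / 4 / α with hδ
  have hδ0 : 0 < δ := by positivity
  have hαδ : α * δ = ε / 4 := by rw [hδ]; field_simp
  have hαδ' : (α - 1) * δ ≤ ε / 4 := by linarith
  obtain ⟨k₀, hk₀⟩ := exists_nat_gt (Real.log 2 / (ε / 4))
  filter_upwards [eventually_half_le_sum_typical (hw0 α) (hw1 α) (g := L) hδ0,
    Filter.eventually_ge_atTop k₀] with k hk hkk
  have hk0 : (0 : ℝ) ≤ k := Nat.cast_nonneg k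
  set D := R - (α * l α - Real.log (Z α)) with hD
  set c := min 1 (Real.exp (-(k * (D + ε / 4)))) with hc
  have hc0 : 0 < c := lt_min one_pos (Real.exp_pos _)
  have hW : ∀ x : Fin k → Y, 0 ≤ ∏ i, w α (x i) := fun x => Finset.prod_nonneg fun i _ => hw0 _ _
  refine ⟨fun x => if |∑ i, L (x i) - k * l α| ≤ k * δ then c else 0, ?_, ?_, ?_⟩
  · intro x
    dsimp only
    split_ifs
    · exact ⟨hc0.le, min_le_left _ _⟩
    · exact ⟨le_rfl, zero_le_one⟩
  · calc _ ≤ ∑ x : Fin k → Y, (∏ i, w α (x i)) * Real.exp (-(k * R)) := by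
          refine Finset.sum_le_sum fun x _ => ?_
          dsimp only
          split_ifs with hx
          · have e1 : ∏ i, q (x i) = (∏ i, w α (x i)) *
                Real.exp (-(α * ∑ i, L (x i) - k * Real.log (Z α))) := by
              rw [Finset.prod_congr rfl fun i _ => hqw α (x i), Finset.prod_mul_distrib,
                ← Real.exp_sum]
              simp [Finset.sum_sub_distrib, Finset.mul_sum]
            rw [e1, mul_assoc]
            refine mul_le_mul_of_nonneg_left ?_ (hW x)
            calc _ ≤ Real.exp (-(α * ∑ i, L (x i) - k * Real.log (Z α))) *
                  Real.exp (-(k * (D + ε / 4))) :=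
                  mul_le_mul_of_nonneg_left (min_le_right _ _) (Real.exp_pos _).le
              _ ≤ _ := by
                  rw [← Real.exp_add, Real.exp_le_exp, hD]
                  have := (abs_le.mp hx).1
                  have h2 : α * (k * l α - k * δ) ≤ α * ∑ i, L (x i) :=
                    mul_le_mul_of_nonneg_left (by linarith) hα0.le
                  have h3 : α * (k * l α - k * δ) = k * (α * l α) - k * (ε / 4) := by
                    rw [← hαδ]; ring
                  linarith
          · rw [mul_zero]
            exact mul_nonneg (hW x) (Real.exp_pos _).le
      _ = _ := by rw [← Finset.sum_mul, sum_prod_eq_one (hw1 α), one_mul]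
  · set A := (α - 1) * l α - Real.log (Z α) with hA
    have hcA : Real.exp (-(k * (C + ε / 2))) ≤ c * Real.exp (-(k * A)) := by
      rw [hc, min_mul_of_nonneg _ _ (Real.exp_pos _).le, one_mul, ← Real.exp_add]
      refine le_min ?_ ?_ <;> rw [Real.exp_le_exp] <;> nlinarith
    have h2 : Real.exp (-(k * (ε / 4))) ≤ 1 / 2 := by
      have : Real.log 2 ≤ k * (ε / 4) := by
        have h3 : Real.log 2 / (ε / 4) ≤ k := hk₀.le.trans (by exact_mod_cast hkk)
        exact (div_le_iff₀ (by positivity)).mp h3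
      calc _ ≤ Real.exp (-Real.log 2) := by rw [Real.exp_le_exp]; linarith
        _ = 1 / 2 := by rw [Real.exp_neg, Real.exp_log two_pos, one_div]
    calc Real.exp (-(k * (C + ε))) = Real.exp (-(k * (C + ε / 2))) *
          Real.exp (-(k * (ε / 4))) * Real.exp (-(k * (ε / 4))) := by
          rw [← Real.exp_add, ← Real.exp_add]; congr 1; ring
      _ ≤ (c * Real.exp (-(k * A))) * Real.exp (-(k * (ε / 4))) * (1 / 2) := by
          gcongr
      _ ≤ (c * Real.exp (-(k * A))) * Real.exp (-(k * (ε / 4))) * ∑ x : Fin k → Y,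
          if |∑ i, L (x i) - k * l α| ≤ k * δ then ∏ i, w α (x i) else 0 := by
          refine mul_le_mul_of_nonneg_left hk (by positivity)
      _ ≤ _ := by
          rw [Finset.mul_sum]
          refine Finset.sum_le_sum fun x _ => ?_
          dsimp only
          split_ifs with hx
          · have e1 : ∏ i, (q (x i) * Real.exp (L (x i))) = (∏ i, w α (x i)) *
                Real.exp (-((α - 1) * ∑ i, L (x i) - k * Real.log (Z α))) := by
              rw [Finset.prod_congr rfl fun i _ => hpw α (x i), Finset.prod_mul_distrib,
                ← Real.exp_sum]
              simp [Finset.sum_sub_distrib, Finset.mul_sum]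
            rw [e1]
            have h3 : Real.exp (-(k * A)) * Real.exp (-(k * (ε / 4))) ≤
                Real.exp (-((α - 1) * ∑ i, L (x i) - k * Real.log (Z α))) := by
              rw [← Real.exp_add, Real.exp_le_exp, hA]
              have := (abs_le.mp hx).2
              have h4 : (α - 1) * ∑ i, L (x i) ≤ (α - 1) * (k * l α + k * δ) :=
                mul_le_mul_of_nonneg_left (by linarith) (by linarith)
              have h5 : k * ((α - 1) * δ) ≤ k * (ε / 4) := mul_le_mul_of_nonneg_left hαδ' hk0
              linarith
            calc _ = (∏ i, w α (x i)) * (Real.exp (-(k * A)) * Real.exp (-(k * (ε / 4)))) * c := by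
                  ring
              _ ≤ _ := mul_le_mul_of_nonneg_right (mul_le_mul_of_nonneg_left h3 (hW x)) hc0.le
          · simp

/-- Achievability of the strong converse exponent for finite distributions. -/
lemma eventually_exists_classical_test {p q : Y → ℝ} (hp : ∀ y, 0 ≤ p y) (hq : ∀ y, 0 ≤ q y)
    (hp1 : ∑ y, p y = 1) (hq1 : ∑ y, q y = 1) (hpq : ∀ y, q y = 0 → p y = 0) {R C : ℝ}
    (h : ∀ α, 1 < α →
      (α - 1) / α * R - 1 / α * Real.log (∑ y, p y ^ α * q y ^ (1 - α)) ≤ C)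
    {ε : ℝ} (hε : 0 < ε) :
    ∀ᶠ k : ℕ in Filter.atTop, ∃ t : (Fin k → Y) → ℝ, (∀ x, 0 ≤ t x ∧ t x ≤ 1) ∧
      ∑ x, (∏ i, q (x i)) * t x ≤ Real.exp (-(k * R)) ∧
      Real.exp (-(k * (C + ε))) ≤ ∑ x, (∏ i, p (x i)) * t x := by
  set q' : Y → ℝ := fun y => if p y = 0 then 0 else q y with hq'
  set L : Y → ℝ := fun y => Real.log (p y) - Real.log (q y) with hL
  have hqp : ∀ y, p y ≠ 0 → 0 < q y := fun y hy =>
    lt_of_le_of_ne (hq y) fun h0 => hy (hpq y h0.symm)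
  have hpp : ∀ y, p y ≠ 0 → 0 < p y := fun y hy => lt_of_le_of_ne (hp y) hy.symm
  have hpe : ∀ y, q' y * Real.exp (L y) = p y := by
    intro y
    simp only [hq', hL]
    split_ifs with h0
    · rw [h0, zero_mul]
    · rw [Real.exp_sub, Real.exp_log (hpp y h0), Real.exp_log (hqp y h0),
        mul_div_cancel₀ _ (hqp y h0).ne']
  have hpα : ∀ α, 1 < α → ∀ y, q' y * Real.exp (α * L y) = p y ^ α * q y ^ (1 - α) := by
    intro α hα y
    simp only [hq', hL]
    split_ifs with h0
    · rw [h0, Real.zero_rpow (by linarith), zero_mul, zero_mul]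
    · rw [Real.rpow_def_of_pos (hpp y h0), Real.rpow_def_of_pos (hqp y h0), ← Real.exp_add]
      nth_rewrite 1 [← Real.exp_log (hqp y h0)]
      rw [← Real.exp_add]
      congr 1; ring
  have hq'0 : ∀ y, 0 ≤ q' y := fun y => by
    simp only [hq']; split_ifs; exacts [le_rfl, hq y]
  have hq'le : ∀ y, q' y ≤ q y := fun y => by
    simp only [hq']; split_ifs; exacts [hq y, le_rfl]
  have key := eventually_exists_test_of_exp (q := q') (L := L) hq'0
    ((Finset.sum_le_sum fun y _ => hq'le y).trans hq1.le) (by simpa only [hpe] using hp1)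
    (R := R) (C := C) (fun α hα => by simpa only [hpα α hα] using h α hα) hε
  filter_upwards [key] with k hk
  obtain ⟨t, ht, h1, h2⟩ := hk
  refine ⟨fun x => if ∃ i, p (x i) = 0 then 0 else t x, ?_, ?_, ?_⟩
  · intro x
    dsimp only
    split_ifs
    exacts [⟨le_rfl, zero_le_one⟩, ht x]
  · refine le_trans (Finset.sum_le_sum fun x _ => ?_) h1
    dsimp only
    split_ifs with hx
    · rw [mul_zero]
      exact mul_nonneg (Finset.prod_nonneg fun i _ => hq'0 _) (ht x).1
    · refine le_of_eq ?_
      congr 1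
      refine Finset.prod_congr rfl fun i _ => ?_
      simp only [hq']
      rw [if_neg fun h0 => hx ⟨i, h0⟩]
  · refine h2.trans (le_of_eq (Finset.sum_congr rfl fun x _ => ?_))
    simp only [hpe]
    split_ifs with hx
    · obtain ⟨i, hi⟩ := hx
      rw [Finset.prod_eq_zero (mem_univ i) hi, zero_mul, zero_mul]
    · rfl

end ClassicalTests

end QRD
namespace QRD

open Matrix Finset

section Tests

variable {m : Type*} [Fintype m] [DecidableEq m]

lemma isTest_zero : IsTest (0 : Matrix m m ℂ) :=
  ⟨PosSemidef.zero, by rw [sub_zero]; exact PosSemidef.one⟩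

lemma isTest_one : IsTest (1 : Matrix m m ℂ) :=
  ⟨PosSemidef.one, by rw [sub_self]; exact PosSemidef.zero⟩

lemma isTest_conjDiag {W : Matrix m m ℂ} (hW : Wᴴ * W = 1) {t : m → ℝ}
    (ht : ∀ i, 0 ≤ t i ∧ t i ≤ 1) : IsTest (conjDiag W t) := by
  refine ⟨conjDiag_posSemidef W fun i => (ht i).1, ?_⟩
  have h : 1 - conjDiag W t = conjDiag W (fun i => 1 - t i) := by
    have h1 : (diagonal fun i => ((1 - t i : ℝ) : ℂ)) = 1 - diagonal fun i => (t i : ℂ) := by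
      rw [← diagonal_one, diagonal_sub]
      simp
    rw [conjDiag, conjDiag, h1, Matrix.mul_sub, Matrix.sub_mul, Matrix.mul_one,
      mul_eq_one_comm.mp hW]
  rw [h]
  exact conjDiag_posSemidef W fun i => sub_nonneg.mpr (ht i).2

lemma IsTest.submatrix {T : Matrix m m ℂ} (hT : IsTest T) {l : Type*} [Fintype l]
    [DecidableEq l] (f : l ≃ m) : IsTest (T.submatrix f f) := by
  refine ⟨hT.1.submatrix f, ?_⟩
  have h : 1 - T.submatrix f f = (1 - T).submatrix f f := by
    ext i j
    simp [one_apply]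
  rw [h]
  exact hT.2.submatrix f

lemma IsTest.smul_one_kronecker {T : Matrix m m ℂ} (hT : IsTest T) (l : Type*) [Fintype l]
    [DecidableEq l] {c : ℝ} (hc0 : 0 ≤ c) (hc1 : c ≤ 1) :
    IsTest (c • kroneckerMap (· * ·) (1 : Matrix l l ℂ) T) := by
  refine ⟨(PosSemidef.one.kronecker hT.1).smul hc0, ?_⟩
  have h : 1 - c • kroneckerMap (· * ·) (1 : Matrix l l ℂ) T =
      (1 - c) • (1 : Matrix (l × m) (l × m) ℂ) +
        c • kroneckerMap (· * ·) (1 : Matrix l l ℂ) (1 - T) := by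
    have h1 : kroneckerMap (· * ·) (1 : Matrix l l ℂ) (1 - T) =
        1 - kroneckerMap (· * ·) (1 : Matrix l l ℂ) T := by
      ext i j
      simp [kroneckerMap_apply, mul_sub, one_apply, Prod.ext_iff, ite_and]
      split_ifs <;> rfl
    rw [h1, smul_sub, sub_smul, one_smul]
    abel
  rw [h]
  exact (PosSemidef.one.smul (sub_nonneg.mpr hc1)).add ((PosSemidef.one.kronecker hT.2).smul hc0)

lemma trace_mul_conjDiag_re {A V : Matrix m m ℂ} {p : m → ℝ}
    (hp : ∀ x, (Vᴴ * A * V) x x = p x) (t : m → ℝ) :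
    (A * conjDiag V t).trace.re = ∑ x, p x * t x := by
  have h : (A * conjDiag V t).trace = (Vᴴ * A * V * diagonal fun i => (t i : ℂ)).trace := by
    rw [conjDiag, ← Matrix.mul_assoc, trace_mul_comm, ← Matrix.mul_assoc, ← Matrix.mul_assoc]
  rw [h, trace, Complex.re_sum]
  refine Finset.sum_congr rfl fun x _ => ?_
  rw [diag_apply, mul_diagonal, hp, ← Complex.ofReal_mul, Complex.ofReal_re]

end Tests

section MaxSuccess

variable {d : ℕ} {ρ σ : Matrix (Fin d) (Fin d) ℂ}

lemma tensorPow_eq_tp (ρ : Matrix (Fin d) (Fin d) ℂ) (N : ℕ) : tensorPow ρ N = tp (Fin N) ρ := rfl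

lemma trace_tensorPow_mul_le_one (hρ : IsDensityMatrix ρ) {N : ℕ}
    {T : Matrix (Fin N → Fin d) (Fin N → Fin d) ℂ} (hT : IsTest T) :
    (tensorPow ρ N * T).trace.re ≤ 1 := by
  have h := trace_mul_re_mono hT.2 (tp_posSemidef (Fin N) hρ.1)
  rw [Matrix.one_mul, trace_tp, hρ.2, one_pow, Complex.one_re, trace_mul_comm] at h
  exact h

lemma le_maxSuccess (hρ : IsDensityMatrix ρ) {r : ℝ} {N : ℕ}
    {T : Matrix (Fin N → Fin d) (Fin N → Fin d) ℂ} (hT : IsTest T)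
    (h : (tensorPow σ N * T).trace.re ≤ Real.exp (-(N * r))) :
    (tensorPow ρ N * T).trace.re ≤ maxSuccess ρ σ r N := by
  refine le_csSup ⟨1, ?_⟩ ⟨T, hT, h, rfl⟩
  rintro x ⟨S, hS, -, rfl⟩
  exact trace_tensorPow_mul_le_one hρ hS

lemma maxSuccess_le {r : ℝ} {N : ℕ} {B : ℝ}
    (h : ∀ T : Matrix (Fin N → Fin d) (Fin N → Fin d) ℂ, IsTest T →
      (tensorPow σ N * T).trace.re ≤ Real.exp (-(N * r)) → (tensorPow ρ N * T).trace.re ≤ B) :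
    maxSuccess ρ σ r N ≤ B := by
  refine csSup_le ⟨_, 0, isTest_zero, ?_, rfl⟩ ?_
  · simpa using (Real.exp_pos _).le
  · rintro x ⟨T, hT, h1, rfl⟩
    exact h T hT h1

lemma maxSuccess_nonneg (hρ : IsDensityMatrix ρ) (r : ℝ) (N : ℕ) : 0 ≤ maxSuccess ρ σ r N := by
  have h := le_maxSuccess (σ := σ) (r := r) (N := N) hρ isTest_zero
    (by simpa using (Real.exp_pos _).le)
  simpa using h

lemma le_maxSuccess_of_equiv (hρ : IsDensityMatrix ρ) {r : ℝ} {N : ℕ} {Y : Type*} [Fintype Y]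
    [DecidableEq Y] (f : (Fin N → Fin d) ≃ Y) {A B T : Matrix Y Y ℂ}
    (hA : tensorPow ρ N = A.submatrix f f) (hB : tensorPow σ N = B.submatrix f f)
    (hT : IsTest T) (h : (B * T).trace.re ≤ Real.exp (-(N * r))) :
    (A * T).trace.re ≤ maxSuccess ρ σ r N := by
  have htr : ∀ C : Matrix Y Y ℂ, (C.submatrix f f * T.submatrix f f).trace = (C * T).trace := by
    intro C
    rw [Matrix.submatrix_mul_equiv]
    exact Equiv.sum_comp f fun i => (C * T) i i
  have h1 := le_maxSuccess (σ := σ) (r := r) hρ (hT.submatrix f) (by rwa [hB, htr])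
  rwa [hA, htr] at h1

lemma tensorPow_succ (ρ : Matrix (Fin d) (Fin d) ℂ) (N : ℕ) :
    tensorPow ρ (N + 1) = (kroneckerMap (· * ·) ρ (tensorPow ρ N)).submatrix
      (Fin.consEquiv fun _ => Fin d).symm (Fin.consEquiv fun _ => Fin d).symm := by
  ext x y
  simp only [tensorPow_eq_tp, tp_apply, submatrix_apply, kroneckerMap_apply, Fin.prod_univ_succ]
  rfl

lemma exp_neg_mul_maxSuccess_le (hρ : IsDensityMatrix ρ) (hσ : IsDensityMatrix σ) {r : ℝ}
    (hr : 0 ≤ r) (N : ℕ) :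
    Real.exp (-r) * maxSuccess ρ σ r N ≤ maxSuccess ρ σ r (N + 1) := by
  have htr : ∀ (τ : Matrix (Fin d) (Fin d) ℂ), τ.trace = 1 →
      ∀ T : Matrix (Fin N → Fin d) (Fin N → Fin d) ℂ,
      (kroneckerMap (· * ·) τ (tensorPow τ N) * (Real.exp (-r) •
        kroneckerMap (· * ·) (1 : Matrix (Fin d) (Fin d) ℂ) T)).trace.re =
      Real.exp (-r) * (tensorPow τ N * T).trace.re := by
    intro τ hτ T
    rw [Matrix.mul_smul, trace_smul, ← mul_kronecker_mul, trace_kronecker, Matrix.mul_one, hτ,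
      one_mul, Complex.smul_re, smul_eq_mul]
  have key : maxSuccess ρ σ r N ≤ Real.exp r * maxSuccess ρ σ r (N + 1) := by
    refine maxSuccess_le fun T hT h => ?_
    have h1 := le_maxSuccess_of_equiv (σ := σ) (r := r) hρ _ (tensorPow_succ ρ N)
      (tensorPow_succ σ N)
      (hT.smul_one_kronecker (Fin d) (Real.exp_pos (-r)).le
        (Real.exp_le_one_iff.mpr (neg_nonpos.mpr hr))) (by
        rw [htr σ hσ.2]
        calc _ ≤ Real.exp (-r) * Real.exp (-(N * r)) :=
              mul_le_mul_of_nonneg_left h (Real.exp_pos _).le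
          _ = _ := by rw [← Real.exp_add]; congr 1; push_cast; ring)
    rw [htr ρ hρ.2] at h1
    calc _ = Real.exp r * (Real.exp (-r) * (tensorPow ρ N * T).trace.re) := by
          rw [← mul_assoc, ← Real.exp_add]; simp
      _ ≤ _ := mul_le_mul_of_nonneg_left h1 (Real.exp_pos _).le
  calc _ ≤ Real.exp (-r) * (Real.exp r * maxSuccess ρ σ r (N + 1)) :=
        mul_le_mul_of_nonneg_left key (Real.exp_pos _).le
    _ = _ := by rw [← mul_assoc, ← Real.exp_add]; simp

lemma exp_neg_mul_maxSuccess_le_add (hρ : IsDensityMatrix ρ) (hσ : IsDensityMatrix σ) {r : ℝ}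
    (hr : 0 ≤ r) (N j : ℕ) :
    Real.exp (-(j * r)) * maxSuccess ρ σ r N ≤ maxSuccess ρ σ r (N + j) := by
  induction j with
  | zero => simp
  | succ j ih =>
    calc _ = Real.exp (-r) * (Real.exp (-(j * r)) * maxSuccess ρ σ r N) := by
          rw [← mul_assoc, ← Real.exp_add]; congr 2; push_cast; ring
      _ ≤ Real.exp (-r) * maxSuccess ρ σ r (N + j) :=
          mul_le_mul_of_nonneg_left ih (Real.exp_pos _).le
      _ ≤ _ := exp_neg_mul_maxSuccess_le hρ hσ hr (N + j)

/-- Splitting `k * m` copies into `k` blocks of `m` copies. -/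
def blockEquiv (d k m : ℕ) : (Fin (k * m) → Fin d) ≃ (Fin k → Fin m → Fin d) :=
  (Equiv.arrowCongr finProdFinEquiv.symm (Equiv.refl _)).trans (Equiv.curry _ _ _)

lemma tensorPow_mul_eq (ρ : Matrix (Fin d) (Fin d) ℂ) (k m : ℕ) :
    tensorPow ρ (k * m) =
      (tp (Fin k) (tp (Fin m) ρ)).submatrix (blockEquiv d k m) (blockEquiv d k m) := by
  ext x y
  simp only [tensorPow_eq_tp, tp_apply, submatrix_apply]
  rw [← Fintype.prod_prod_type' (f := fun i j => ρ (blockEquiv d k m x i j) (blockEquiv d k m y i j)),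
    ← Equiv.prod_comp finProdFinEquiv]
  rfl

end MaxSuccess

section Bounds

variable {d : ℕ} {ρ σ : Matrix (Fin d) (Fin d) ℂ}

lemma qReal_pos {α : ℝ} (hα : 1 < α) (hρ : IsDensityMatrix ρ) (hσ : IsDensityMatrix σ)
    (hs : suppLE ρ σ) : 0 < qReal α ρ σ := by
  refine lt_of_le_of_ne (qReal_nonneg hα hρ.1 hσ.1) fun h0 => ?_
  have h := trace_tp_mul_test_le (Fin 1) hα hρ.1 hσ.1 hs isTest_one
  rw [Matrix.mul_one, Matrix.mul_one, trace_tp, trace_tp, hρ.2, hσ.2, ← h0] at h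
  have hα' : α ≠ 0 := by linarith
  simp [Real.zero_rpow (inv_ne_zero hα')] at h
  linarith

lemma Dstar_eq {α : ℝ} (hα : 1 < α) (hρ : IsDensityMatrix ρ) (hσ : IsDensityMatrix σ)
    (hs : suppLE ρ σ) :
    Dstar α ρ σ = (((α - 1)⁻¹ * Real.log (qReal α ρ σ) : ℝ) : EReal) := by
  rw [Dstar, Qstar, if_neg (by tauto), EReal.coe_mul]
  congr 1
  exact ENNReal.log_ofReal_of_pos (qReal_pos hα hρ hσ hs)

/-- The function optimized in the Hoeffding anti-divergence. -/
noncomputable def hoeffdingTerm (r : ℝ) (ρ σ : Matrix (Fin d) (Fin d) ℂ) (α : ℝ) : ℝ :=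
  (α - 1) / α * r - 1 / α * Real.log (qReal α ρ σ)

lemma Hstar_eq_iSup (r : ℝ) (hρ : IsDensityMatrix ρ) (hσ : IsDensityMatrix σ)
    (hs : suppLE ρ σ) :
    Hstar r ρ σ = ⨆ α ∈ Set.Ioi (1 : ℝ), (hoeffdingTerm r ρ σ α : EReal) := by
  refine iSup_congr fun α => iSup_congr fun hα => ?_
  have hα1 : α - 1 ≠ 0 := sub_ne_zero.mpr (ne_of_gt hα)
  have hα0 : α ≠ 0 := by have : (1 : ℝ) < α := hα; linarith
  rw [Dstar_eq hα hρ hσ hs, ← EReal.coe_sub, ← EReal.coe_mul, hoeffdingTerm]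
  congr 1
  field_simp

lemma maxSuccess_le_exp {α : ℝ} (hα : 1 < α) (hρ : IsDensityMatrix ρ) (hσ : IsDensityMatrix σ)
    (hs : suppLE ρ σ) (r : ℝ) (N : ℕ) :
    maxSuccess ρ σ r N ≤ Real.exp (-(N * hoeffdingTerm r ρ σ α)) := by
  refine maxSuccess_le fun T hT h => ?_
  have hα0 : 0 < α := by linarith
  have hq := qReal_pos hα hρ hσ hs
  have h1 := trace_tp_mul_test_le (Fin N) hα hρ.1 hσ.1 hs hT
  refine h1.trans ?_
  calc _ ≤ (qReal α ρ σ ^ Fintype.card (Fin N)) ^ (1 / α) *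
        Real.exp (-(N * r)) ^ ((α - 1) / α) := by
        refine mul_le_mul_of_nonneg_left (Real.rpow_le_rpow
          (trace_mul_re_nonneg (tp_posSemidef _ hσ.1) hT.1) h ?_) (by positivity)
        exact div_nonneg (by linarith) hα0.le
    _ = _ := by
        rw [Fintype.card_fin, ← Real.exp_mul, hoeffdingTerm]
        nth_rewrite 1 [← Real.exp_log hq]
        rw [← Real.exp_nat_mul, ← Real.exp_mul, ← Real.exp_add]
        congr 1; ring

lemma exists_eigenbasis_distributions (m : ℕ) (hρ : IsDensityMatrix ρ)
    (hσ : IsDensityMatrix σ) (hs : suppLE ρ σ) :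
    ∃ (V : Matrix (Fin m → Fin d) (Fin m → Fin d) ℂ) (p q : (Fin m → Fin d) → ℝ),
      IsSpectral (tp (Fin m) σ) V q ∧ (∀ x, (Vᴴ * tp (Fin m) ρ * V) x x = p x) ∧
      (∀ x, 0 ≤ p x) ∧ (∀ x, 0 ≤ q x) ∧ ∑ x, p x = 1 ∧ ∑ x, q x = 1 ∧
      (∀ x, q x = 0 → p x = 0) ∧
      ∀ α, 1 < α → qReal α ρ σ ^ m ≤
        (((m + 1) ^ d : ℕ) : ℝ) ^ α * ∑ x, p x ^ α * q x ^ (1 - α) := by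
  obtain ⟨V, p, q, hV, hp, hp0, hq0, hb⟩ := exists_eigenbasis_measurement (Fin m) hρ.1 hσ.1
  refine ⟨V, p, q, hV, hp, hp0, hq0, ?_, ?_, ?_, by simpa using hb⟩
  · have h1 : (Vᴴ * tp (Fin m) ρ * V).trace = 1 := by
      rw [trace_mul_comm, ← Matrix.mul_assoc, hV.unitary', Matrix.one_mul, trace_tp, hρ.2, one_pow]
    simp only [trace, diag_apply, hp] at h1
    exact_mod_cast h1
  · have h1 := trace_conjDiag hV.unitary q
    rw [conjDiag, ← hV.eq, trace_tp, hσ.2, one_pow] at h1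
    exact_mod_cast h1.symm
  · intro x hx
    set t : (Fin m → Fin d) → ℝ := Pi.single x 1 with ht
    have hT : IsTest (conjDiag V t) := isTest_conjDiag hV.unitary fun i => by
      rcases eq_or_ne i x with rfl | h
      · simp [ht]
      · simp [ht, h]
    have h := trace_tp_mul_test_le (Fin m) one_lt_two hρ.1 hσ.1 hs hT
    have h1 : tp (Fin m) σ * conjDiag V t = 0 := by
      have h2 : tp (Fin m) σ = conjDiag V q := hV.eq
      have h3 : (fun i => q i * t i) = fun _ => (0 : ℝ) := by
        ext i
        rcases eq_or_ne i x with rfl | h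
        · simp [hx]
        · simp [ht, h]
      rw [h2, conjDiag_mul hV.unitary, h3]
      simp [conjDiag]
    rw [h1, trace_mul_conjDiag_re hp] at h
    norm_num at h
    have h4 : ∑ i, p i * t i = p x := by simp [ht, Pi.single_apply]
    rw [h4] at h
    exact le_antisymm h (hp0 x)

end Bounds

end QRD
namespace QRD

open Matrix Finset

section Achievability

variable {d : ℕ} {ρ σ : Matrix (Fin d) (Fin d) ℂ}

lemma tp_conjTranspose_mul_mul_diag {X κ : Type*} [Fintype X] [DecidableEq X] [Fintype κ]
    [DecidableEq κ] {V A : Matrix X X ℂ} {p : X → ℝ} (hp : ∀ x, (Vᴴ * A * V) x x = p x)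
    (x : κ → X) :
    ((tp κ V)ᴴ * tp κ A * tp κ V) x x = ((∏ i, p (x i) : ℝ) : ℂ) := by
  rw [← tp_conjTranspose, ← tp_mul, ← tp_mul, tp_apply, Complex.ofReal_prod]
  exact Finset.prod_congr rfl fun i _ => hp (x i)

lemma eventually_exp_le_maxSuccess_block (hρ : IsDensityMatrix ρ) (hσ : IsDensityMatrix σ)
    (hs : suppLE ρ σ) {r c : ℝ} (h : ∀ α, 1 < α → hoeffdingTerm r ρ σ α ≤ c) (m : ℕ)
    {ε : ℝ} (hε : 0 < ε) :
    ∀ᶠ k : ℕ in Filter.atTop,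
      Real.exp (-(k * (m * c + d * Real.log (m + 1) + ε))) ≤ maxSuccess ρ σ r (k * m) := by
  obtain ⟨V, p, q, hV, hp, hp0, hq0, hp1, hq1, hpq, hb⟩ :=
    exists_eigenbasis_distributions m hρ hσ hs
  have hq : ∀ x, (Vᴴ * tp (Fin m) σ * V) x x = q x := by
    intro x
    have : Vᴴ * tp (Fin m) σ * V = diagonal fun i => (q i : ℂ) := by
      calc _ = (Vᴴ * V) * diagonal (fun i => (q i : ℂ)) * (Vᴴ * V) := by
            rw [hV.eq]; simp only [Matrix.mul_assoc]
        _ = _ := by rw [hV.unitary, Matrix.one_mul, Matrix.mul_one]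
    rw [this, diagonal_apply_eq]
  have hclass : ∀ α, 1 < α → (α - 1) / α * (m * r) -
      1 / α * Real.log (∑ y, p y ^ α * q y ^ (1 - α)) ≤ m * c + d * Real.log (m + 1) := by
    intro α hα
    have hα0 : 0 < α := by linarith
    have hQ := qReal_pos hα hρ hσ hs
    set S := ∑ y, p y ^ α * q y ^ (1 - α) with hS
    have hM : (0 : ℝ) < (((m + 1) ^ d : ℕ) : ℝ) := by positivity
    have h1 := hb α hα
    have hS0 : 0 < S :=
      pos_of_mul_pos_right ((pow_pos hQ m).trans_le h1) (Real.rpow_nonneg hM.le _)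
    have h2 := Real.log_le_log (pow_pos hQ m) h1
    rw [Real.log_mul (Real.rpow_pos_of_pos hM _).ne' hS0.ne', Real.log_rpow hM, Real.log_pow,
      Nat.cast_pow, Real.log_pow] at h2
    push_cast at h2
    have h3 : m * hoeffdingTerm r ρ σ α ≤ m * c :=
      mul_le_mul_of_nonneg_left (h α hα) (Nat.cast_nonneg m)
    rw [hoeffdingTerm] at h3
    have h4 : 1 / α * (m * Real.log (qReal α ρ σ)) ≤
        1 / α * (α * (d * Real.log (m + 1)) + Real.log S) :=
      mul_le_mul_of_nonneg_left h2 (by positivity)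
    have h5 : 1 / α * (α * (d * Real.log (m + 1)) + Real.log S) =
        d * Real.log (m + 1) + 1 / α * Real.log S := by
      field_simp
    linarith
  filter_upwards [eventually_exists_classical_test hp0 hq0 hp1 hq1 hpq hclass hε]
    with k ⟨t, ht, h1, h2⟩
  have hσt := trace_mul_conjDiag_re (fun x => tp_conjTranspose_mul_mul_diag (κ := Fin k) hq x) t
  have hρt := trace_mul_conjDiag_re (fun x => tp_conjTranspose_mul_mul_diag (κ := Fin k) hp x) t
  refine h2.trans (hρt ▸ le_maxSuccess_of_equiv hρ _ (tensorPow_mul_eq ρ k m)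
    (tensorPow_mul_eq σ k m) (isTest_conjDiag (tp_unitary _ hV.unitary) ht) ?_)
  rw [hσt]
  refine h1.trans_eq ?_
  congr 1
  push_cast
  ring

lemma exists_nat_mul_log_succ_le (d : ℕ) {ε : ℝ} (hε : 0 < ε) :
    ∃ m : ℕ, 0 < m ∧ d * Real.log (m + 1) ≤ m * ε := by
  have hδ : 0 < ε / (2 * (d + 1)) := by positivity
  have h1 := (Real.isLittleO_log_id_atTop.bound hδ)
  have h2 := (tendsto_natCast_atTop_atTop (R := ℝ)).eventually h1
  obtain ⟨n, hn, hn2⟩ := (h2.and (Filter.eventually_ge_atTop 2)).exists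
  obtain ⟨m, rfl⟩ : ∃ m, n = m + 1 := ⟨n - 1, by omega⟩
  refine ⟨m, by omega, ?_⟩
  have hm : (1 : ℝ) ≤ m := by exact_mod_cast (by omega : 1 ≤ m)
  have h3 := (le_abs_self _).trans hn
  simp only [id, Real.norm_eq_abs, Nat.cast_add, Nat.cast_one] at h3
  rw [abs_of_nonneg (by positivity : (0 : ℝ) ≤ m + 1)] at h3
  have h0 : 0 ≤ Real.log ((m : ℝ) + 1) := Real.log_nonneg (by linarith)
  calc d * Real.log (m + 1) ≤ (d + 1) * Real.log (m + 1) := by linarith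
    _ ≤ (d + 1) * (ε / (2 * (d + 1)) * (m + 1)) :=
        mul_le_mul_of_nonneg_left h3 (by positivity)
    _ = ε * ((m + 1) / 2) := by field_simp
    _ ≤ ε * m := mul_le_mul_of_nonneg_left (by linarith) hε.le
    _ = _ := mul_comm _ _

lemma eventually_exp_le_maxSuccess (hρ : IsDensityMatrix ρ) (hσ : IsDensityMatrix σ)
    (hs : suppLE ρ σ) {r c : ℝ} (hr : 0 ≤ r) (h : ∀ α, 1 < α → hoeffdingTerm r ρ σ α ≤ c)
    {ε : ℝ} (hε : 0 < ε) :
    ∀ᶠ N : ℕ in Filter.atTop, Real.exp (-(N * (c + ε))) ≤ maxSuccess ρ σ r N := by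
  obtain ⟨m, hm0, hm⟩ := exists_nat_mul_log_succ_le d (show 0 < ε / 4 by positivity)
  have hmR : (0 : ℝ) < m := by exact_mod_cast hm0
  obtain ⟨k₀, hk₀⟩ := Filter.eventually_atTop.mp
    (eventually_exp_le_maxSuccess_block hρ hσ hs h m (show 0 < m * (ε / 4) by positivity))
  obtain ⟨k₁, hk₁⟩ := exists_nat_ge (2 * |r - c| / ε)
  filter_upwards [Filter.eventually_ge_atTop (max k₀ k₁ * m)] with N hN
  have hk : max k₀ k₁ ≤ N / m := (Nat.le_div_iff_mul_le hm0).mpr hN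
  set k := N / m
  set j := N % m
  have hNkj : k * m + j = N := Nat.div_add_mod' N m
  have hj : (j : ℝ) ≤ m := by exact_mod_cast (Nat.mod_lt N hm0).le
  have hj0 : (0 : ℝ) ≤ j := Nat.cast_nonneg j
  have hkk : 2 * |r - c| / ε ≤ k := hk₁.trans (by exact_mod_cast (le_max_right _ _).trans hk)
  have hk1 : |r - c| ≤ k * (ε / 2) := by
    rw [div_le_iff₀ hε] at hkk; linarith
  have hNR : (N : ℝ) = k * m + j := by rw [← hNkj]; push_cast; ring
  have h1 := hk₀ k ((le_max_left _ _).trans hk)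
  have h2 := exp_neg_mul_maxSuccess_le_add hρ hσ hr (k * m) j
  rw [hNkj] at h2
  refine le_trans ?_ ((mul_le_mul_of_nonneg_left h1 (Real.exp_pos _).le).trans h2)
  rw [← Real.exp_add, Real.exp_le_exp, hNR]
  have h3 : j * (r - c) ≤ m * (k * (ε / 2)) :=
    (mul_le_mul_of_nonneg_left ((le_abs_self _).trans hk1) hj0).trans
      (mul_le_mul_of_nonneg_right hj (by positivity))
  have h4 : k * (d * Real.log (m + 1)) ≤ k * (m * (ε / 4)) :=
    mul_le_mul_of_nonneg_left hm (Nat.cast_nonneg k)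
  have h5 : 0 ≤ j * ε := by positivity
  linarith

end Achievability

lemma coe_le_expRate {N : ℕ} (hN : 0 < N) {x a : ℝ} (hx : 0 ≤ x)
    (h : x ≤ Real.exp (-(N * a))) : (a : EReal) ≤ expRate N x := by
  rw [expRate]
  split_ifs with h0
  · exact le_top
  · have hNR : (0 : ℝ) < N := by exact_mod_cast hN
    have h1 := (Real.log_le_iff_le_exp (lt_of_le_of_ne hx (Ne.symm h0))).mpr h
    rw [EReal.coe_le_coe_iff, neg_mul, ← mul_neg, ← div_eq_inv_mul, le_div_iff₀ hNR]
    linarith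

lemma expRate_le_coe {N : ℕ} (hN : 0 < N) {x a : ℝ}
    (h : Real.exp (-(N * a)) ≤ x) : expRate N x ≤ a := by
  have hx : 0 < x := (Real.exp_pos _).trans_le h
  have hNR : (0 : ℝ) < N := by exact_mod_cast hN
  have h1 := (Real.le_log_iff_exp_le hx).mpr h
  rw [expRate, if_neg hx.ne', EReal.coe_le_coe_iff, neg_mul, ← mul_neg, ← div_eq_inv_mul,
    div_le_iff₀ hNR]
  linarith

end QRD

open QRD in
/-- For density matrices `ρ`, `σ` on `ℂ^d` with `s(ρ) ≤ s(σ)` and every `r ≥ 0`, the limit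
`lim_{n→∞} −(1/n) log β_n(r)` of the maximal type I success probabilities exists and
equals the Hoeffding anti-divergence `H*_r(ρ‖σ)`. -/
theorem tendsto_expRate_maxSuccess
    {d : ℕ} (ρ σ : Matrix (Fin d) (Fin d) ℂ)
    (hρ : IsDensityMatrix ρ) (hσ : IsDensityMatrix σ)
    (hsupp : suppLE ρ σ) (r : ℝ) (hr : 0 ≤ r) :
    Filter.Tendsto (fun N => expRate N (maxSuccess ρ σ r N)) Filter.atTop
      (nhds (Hstar r ρ σ)) := by
  rw [Hstar_eq_iSup r hρ hσ hsupp]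
  refine tendsto_order.mpr ⟨fun a ha => ?_, fun b hb => ?_⟩
  · obtain ⟨α, ha⟩ := lt_iSup_iff.mp ha
    obtain ⟨hα, ha⟩ := lt_iSup_iff.mp ha
    filter_upwards [Filter.eventually_gt_atTop 0] with N hN
    exact ha.trans_le (coe_le_expRate hN (maxSuccess_nonneg hρ r N)
      (maxSuccess_le_exp hα hρ hσ hsupp r N))
  · obtain ⟨c', hc', hb'⟩ := EReal.lt_iff_exists_real_btwn.mp hb
    obtain ⟨c, hc, hcc'⟩ := EReal.lt_iff_exists_real_btwn.mp hc'
    have h : ∀ α, 1 < α → hoeffdingTerm r ρ σ α ≤ c := fun α hα => by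
      have h1 := (le_iSup₂ (f := fun α (_ : α ∈ Set.Ioi (1 : ℝ)) =>
        (hoeffdingTerm r ρ σ α : EReal)) α hα).trans hc.le
      exact EReal.coe_le_coe_iff.mp h1
    filter_upwards [Filter.eventually_gt_atTop 0, eventually_exp_le_maxSuccess hρ hσ hsupp hr h
      (sub_pos.mpr (EReal.coe_lt_coe_iff.mp hcc'))] with N hN hN'
    rw [add_sub_cancel] at hN'
    exact (expRate_le_coe hN hN').trans_lt hb'
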